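/- Under the non-stationary zero-returns model with mixing, and with the kernel estimators defined from a kernel and bandwidth satisfying the kernel and bandwidth assumption, if Δ = Σ_{h=1}^m Δ_h² = 0, then the index κ̂_m = Σ_{h=1}^m Δ̂_h² converges in probability to 0 as n → ∞. -/

import Mathlib

open MeasureTheory ProbabilityTheory Filter Set

namespace ZeroReturnsNS

variable {Ω : Type*} [MeasurableSpace Ω]

/-- A function is piecewise Lipschitz on `(0,1]` if `(0,1]` is a finite disjoint union of
intervals on each of which the function is Lipschitz. -/
def PiecewiseLipschitzOn01 (f : ℝ → ℝ) : Prop :=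
  ∃ (p : ℕ) (I : Fin p → Set ℝ) (C : Fin p → NNReal),
    (∀ l, (I l).OrdConnected) ∧
    Pairwise (Function.onFun Disjoint I) ∧
    (⋃ l, I l) = Set.Ioc (0 : ℝ) 1 ∧
    ∀ l, LipschitzOnWith (C l) f (I l)

/-- The triangular array of returns `r_t = v(t/n) ε_t`. -/
noncomputable def rproc (v : ℝ → ℝ) (ε : ℕ → ℕ → Ω → ℝ) (n t : ℕ) (ω : Ω) : ℝ :=
  v ((t : ℝ) / n) * ε n t ω

/-- The zero-return indicator `a_t = 1_{r_t ≠ 0}`. -/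
noncomputable def aproc (v : ℝ → ℝ) (ε : ℕ → ℕ → Ω → ℝ) (n t : ℕ) (ω : Ω) : ℝ :=
  if rproc v ε n t ω ≠ 0 then 1 else 0

/-- The σ-field `σ(ε_u : u ≤ t)` of the past of the `n`-th row of the array. -/
noncomputable def pastField (ε : ℕ → ℕ → Ω → ℝ) (n t : ℕ) : MeasurableSpace Ω :=
  ⨆ u ∈ {u : ℕ | u ≤ t}, MeasurableSpace.comap (ε n u) inferInstance

/-- The σ-field `σ(ε_u : u ≥ t)` of the future of the `n`-th row of the array. -/
noncomputable def futureField (ε : ℕ → ℕ → Ω → ℝ) (n t : ℕ) : MeasurableSpace Ω :=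
  ⨆ u ∈ {u : ℕ | t ≤ u}, MeasurableSpace.comap (ε n u) inferInstance

/-- The strong (α-)mixing coefficients of `(ε_t)`:
`α_ε(h) = sup { |P(A∩B) - P(A)P(B)| : A ∈ σ(ε_u : u ≤ t), B ∈ σ(ε_u : u ≥ t+h) }`. -/
noncomputable def alphaMix (μ : Measure Ω) (ε : ℕ → ℕ → Ω → ℝ) (h : ℕ) : ℝ :=
  ⨆ n : ℕ, ⨆ t : ℕ, sSup {x : ℝ | ∃ A B : Set Ω,
    MeasurableSet[pastField ε n t] A ∧ MeasurableSet[futureField ε n (t + h)] B ∧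
    x = |(μ (A ∩ B)).toReal - (μ A).toReal * (μ B).toReal|}

/-- `K_{ti} = K((t-i)/(nb))` for `t ≠ i`, and `K_{tt} = 0`. -/
noncomputable def Kw (K : ℝ → ℝ) (b : ℕ → ℝ) (n t i : ℕ) : ℝ :=
  if t = i then 0 else K (((t : ℝ) - (i : ℝ)) / ((n : ℝ) * b n))

/-- The kernel weights `w_{tj}(b) = K_{tj} / Σ_{i=1}^n K_{ti}`. -/
noncomputable def wgt (K : ℝ → ℝ) (b : ℕ → ℝ) (n t j : ℕ) : ℝ :=
  Kw K b n t j / ∑ i ∈ Finset.Icc 1 n, Kw K b n t i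

/-- The kernel estimator `p̂_t = Σ_{j=1}^n w_{tj}(b) a_j` of `P(a_t = 1)`. -/
noncomputable def phat (v : ℝ → ℝ) (ε : ℕ → ℕ → Ω → ℝ) (K : ℝ → ℝ) (b : ℕ → ℝ)
    (n t : ℕ) (ω : Ω) : ℝ :=
  ∑ j ∈ Finset.Icc 1 n, wgt K b n t j * aproc v ε n j ω

/-- The kernel estimator `p̂_{t,t-h} = Σ_{j=1+h}^n w_{tj}(b) a_j a_{j-h}` of
`P(a_t a_{t-h} = 1)`. -/
noncomputable def phat2 (v : ℝ → ℝ) (ε : ℕ → ℕ → Ω → ℝ) (K : ℝ → ℝ) (b : ℕ → ℝ)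
    (n h t : ℕ) (ω : Ω) : ℝ :=
  ∑ j ∈ Finset.Icc (h + 1) n, wgt K b n t j * (aproc v ε n j ω * aproc v ε n (j - h) ω)

/-- `γ̂_{ar²}(h) = (n-h)⁻¹ Σ_{t=1+h}^n r_t² p̂_{t,t-h}/p̂_t`
(terms with `p̂_t = 0` are set to zero). -/
noncomputable def gammaAr2 (v : ℝ → ℝ) (ε : ℕ → ℕ → Ω → ℝ) (K : ℝ → ℝ) (b : ℕ → ℝ)
    (n h : ℕ) (ω : Ω) : ℝ :=
  ((n : ℝ) - (h : ℝ))⁻¹ * ∑ t ∈ Finset.Icc (h + 1) n, (rproc v ε n t ω) ^ 2 *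
    (if phat v ε K b n t ω = 0 then 0 else phat2 v ε K b n h t ω / phat v ε K b n t ω)

/-- `γ̂_0(h) = n⁻¹ Σ_{t=1+h}^n r_t r_{t-h}`. -/
noncomputable def gammaHat0 (v : ℝ → ℝ) (ε : ℕ → ℕ → Ω → ℝ) (n h : ℕ) (ω : Ω) : ℝ :=
  (n : ℝ)⁻¹ * ∑ t ∈ Finset.Icc (h + 1) n, rproc v ε n t ω * rproc v ε n (t - h) ω

/-- `γ̂_a(h) = n⁻¹ Σ_{t=1+h}^n a_t a_{t-h}`. -/
noncomputable def gammaHatA (v : ℝ → ℝ) (ε : ℕ → ℕ → Ω → ℝ) (n h : ℕ) (ω : Ω) : ℝ :=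
  (n : ℝ)⁻¹ * ∑ t ∈ Finset.Icc (h + 1) n, aproc v ε n t ω * aproc v ε n (t - h) ω

/-- `ρ̂_0(h) = γ̂_0(h)/γ̂_0(0)`. -/
noncomputable def rhoHat0 (v : ℝ → ℝ) (ε : ℕ → ℕ → Ω → ℝ) (n h : ℕ) (ω : Ω) : ℝ :=
  gammaHat0 v ε n h ω / gammaHat0 v ε n 0 ω

/-- `ρ̂_vpr(h) = (γ̂_0(0)/γ̂_{ar²}(h)) ρ̂_0(h)`. -/
noncomputable def rhoHatVpr (v : ℝ → ℝ) (ε : ℕ → ℕ → Ω → ℝ) (K : ℝ → ℝ) (b : ℕ → ℝ)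
    (n h : ℕ) (ω : Ω) : ℝ :=
  (gammaHat0 v ε n 0 ω / gammaAr2 v ε K b n h ω) * rhoHat0 v ε n h ω

/-- `ρ̂_pr(h) = ρ̂_0(h) γ̂_a(0)/γ̂_a(h)`. -/
noncomputable def rhoHatPr (v : ℝ → ℝ) (ε : ℕ → ℕ → Ω → ℝ) (n h : ℕ) (ω : Ω) : ℝ :=
  rhoHat0 v ε n h ω * (gammaHatA v ε n 0 ω / gammaHatA v ε n h ω)

end ZeroReturnsNS

namespace ZeroReturnsNS

/-- The empirical index component `Δ̂_h`. -/
noncomputable def DeltaHat (v : ℝ → ℝ) (ε : ℕ → ℕ → Ω → ℝ) (K : ℝ → ℝ) (b : ℕ → ℝ)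
    (n h : ℕ) (ω : Ω) : ℝ :=
  ((n : ℝ)⁻¹ * ∑ t ∈ Finset.Icc 1 n, (rproc v ε n t ω) ^ 2) / gammaAr2 v ε K b n h ω
    - ((n : ℝ)⁻¹ * ∑ t ∈ Finset.Icc 1 n, aproc v ε n t ω)
      / (((n : ℝ) - (h : ℝ))⁻¹ *
          ∑ t ∈ Finset.Icc (h + 1) n, aproc v ε n t ω * aproc v ε n (t - h) ω)

/-- The population index component
`Δ_h = (∫₀¹ v² g_0)/(∫₀¹ v² g_h) − (∫₀¹ g_0)/(∫₀¹ g_h)`. -/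
noncomputable def Delta (v : ℝ → ℝ) (g : ℕ → ℝ → ℝ) (h : ℕ) : ℝ :=
  (∫ s in Set.Ioc (0 : ℝ) 1, (v s) ^ 2 * g 0 s) /
      (∫ s in Set.Ioc (0 : ℝ) 1, (v s) ^ 2 * g h s)
    - (∫ s in Set.Ioc (0 : ℝ) 1, g 0 s) / (∫ s in Set.Ioc (0 : ℝ) 1, g h s)

section Lemmas

variable {Ω : Type*}

/-- Averages of a bounded triangular array converge to the integral of its pointwise limit
along `t = ⌈n s⌉`. -/
theorem tendsto_average_of_ae_tendsto_ceil {F : ℕ → ℕ → ℝ} {f : ℝ → ℝ} {C : ℝ}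
    (hF : ∀ n t, 1 ≤ t → t ≤ n → |F n t| ≤ C)
    (hlim : ∀ᵐ s ∂(volume.restrict (Ioc (0 : ℝ) 1)),
      Tendsto (fun n : ℕ => F n ⌈(n : ℝ) * s⌉₊) atTop (nhds (f s))) :
    Tendsto (fun n : ℕ => (n : ℝ)⁻¹ * ∑ t ∈ Finset.Icc 1 n, F n t) atTop
      (nhds (∫ s in Ioc (0 : ℝ) 1, f s)) := by
  have hmeas : ∀ n : ℕ, Measurable (fun s : ℝ => F n ⌈(n : ℝ) * s⌉₊) := fun n =>
    (measurable_from_nat (f := F n)).comp (Nat.measurable_ceil.comp (measurable_const_mul _))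
  have hceil : ∀ n : ℕ, 0 < n → ∀ s ∈ Ioc (0 : ℝ) 1,
      1 ≤ ⌈(n : ℝ) * s⌉₊ ∧ ⌈(n : ℝ) * s⌉₊ ≤ n := by
    intro n hn s hs
    have hn' : (0 : ℝ) < n := by exact_mod_cast hn
    refine ⟨Nat.one_le_ceil_iff.2 (mul_pos hn' hs.1), Nat.ceil_le.2 ?_⟩
    nlinarith [hs.2]
  have hbound : ∀ n : ℕ, 0 < n → ∀ s ∈ Ioc (0 : ℝ) 1, ‖F n ⌈(n : ℝ) * s⌉₊‖ ≤ C :=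
    fun n hn s hs => hF n _ (hceil n hn s hs).1 (hceil n hn s hs).2
  have hint := tendsto_integral_filter_of_dominated_convergence
    (μ := volume.restrict (Ioc (0 : ℝ) 1)) (l := atTop)
    (F := fun (n : ℕ) s => F n ⌈(n : ℝ) * s⌉₊) (f := f) (fun _ => C)
    (Eventually.of_forall fun n => (hmeas n).aestronglyMeasurable)
    ((eventually_gt_atTop 0).mono fun n hn =>
      (ae_restrict_mem measurableSet_Ioc).mono fun s hs => hbound n hn s hs)
    (integrable_const _) hlim
  refine hint.congr' ?_
  filter_upwards [eventually_gt_atTop 0] with n hn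
  have hn' : (0 : ℝ) < n := by exact_mod_cast hn
  have hpiece : ∀ k : ℕ, ∀ s ∈ Ioc ((k : ℝ) / n) (((k + 1 : ℕ) : ℝ) / n),
      F n ⌈(n : ℝ) * s⌉₊ = F n (k + 1) := by
    intro k s hs
    congr 1
    rw [Nat.ceil_eq_iff (by omega)]
    have h1 := (div_lt_iff₀ hn').1 hs.1
    have h2 := (le_div_iff₀ hn').1 hs.2
    simp only [Nat.add_sub_cancel]
    constructor <;> linarith
  have hle : ∀ k : ℕ, (k : ℝ) / n ≤ ((k + 1 : ℕ) : ℝ) / n := fun k => by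
    gcongr; omega
  have hone : ∀ k : ℕ, ∫ s in ((k : ℝ) / n)..(((k + 1 : ℕ) : ℝ) / n), F n ⌈(n : ℝ) * s⌉₊
      = (n : ℝ)⁻¹ * F n (k + 1) := by
    intro k
    rw [intervalIntegral.integral_of_le (hle k), setIntegral_congr_fun measurableSet_Ioc (hpiece k),
      ← intervalIntegral.integral_of_le (hle k), intervalIntegral.integral_const, smul_eq_mul]
    congr 1
    push_cast
    field_simp
    ring
  have hadj := intervalIntegral.sum_integral_adjacent_intervals (μ := volume)
    (f := fun s : ℝ => F n ⌈(n : ℝ) * s⌉₊) (a := fun k : ℕ => (k : ℝ) / n) (n := n) (by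
      intro k _
      rw [intervalIntegrable_iff_integrableOn_Ioc_of_le (hle k)]
      refine (integrableOn_congr_fun (hpiece k) measurableSet_Ioc).2 ?_
      exact integrableOn_const (by simp))
  simp only [hone] at hadj
  rw [Nat.cast_zero, zero_div, div_self hn'.ne', intervalIntegral.integral_of_le zero_le_one]
    at hadj
  rw [← hadj, ← Finset.mul_sum, Finset.range_eq_Ico, Finset.sum_Ico_add' (fun k => F n k) 0 n 1]
  rfl

theorem PiecewiseLipschitzOn01.ae_continuousAt {f : ℝ → ℝ} (hf : PiecewiseLipschitzOn01 f) :
    ∀ᵐ s ∂(volume.restrict (Ioc (0 : ℝ) 1)), ContinuousAt f s := by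
  obtain ⟨p, I, C, hI, -, hU, hL⟩ := hf
  have hfr : ∀ᵐ s : ℝ, ∀ l, s ∉ frontier (I l) := by
    refine ae_all_iff.2 fun l => ?_
    exact measure_eq_zero_iff_ae_notMem.1 ((hI l).convex.addHaar_frontier volume)
  filter_upwards [ae_restrict_of_ae hfr, ae_restrict_mem measurableSet_Ioc] with s hs hmem
  rw [← hU] at hmem
  obtain ⟨l, hl⟩ := mem_iUnion.1 hmem
  have hint : s ∈ interior (I l) := by
    by_contra hcon
    exact hs l ⟨subset_closure hl, hcon⟩
  exact (hL l).continuousOn.continuousAt (mem_interior_iff_mem_nhds.1 hint)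

theorem measurable_of_le_pastField (ε : ℕ → ℕ → Ω → ℝ) {n t u : ℕ} (hu : u ≤ t) :
    Measurable[pastField ε n t] (ε n u) :=
  (comap_measurable (ε n u)).mono
    (le_iSup₂ (f := fun u (_ : u ∈ {u : ℕ | u ≤ t}) =>
      MeasurableSpace.comap (ε n u) inferInstance) u hu) le_rfl

theorem measurable_of_futureField_le (ε : ℕ → ℕ → Ω → ℝ) {n t u : ℕ} (hu : t ≤ u) :
    Measurable[futureField ε n t] (ε n u) :=
  (comap_measurable (ε n u)).mono
    (le_iSup₂ (f := fun u (_ : u ∈ {u : ℕ | t ≤ u}) =>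
      MeasurableSpace.comap (ε n u) inferInstance) u hu) le_rfl

theorem measurable_aproc (v : ℝ → ℝ) (ε : ℕ → ℕ → Ω → ℝ) {n t : ℕ} {m : MeasurableSpace Ω}
    (hm : Measurable[m] (ε n t)) : Measurable[m] (aproc v ε n t) := by
  have hset : MeasurableSet[m] {ω | rproc v ε n t ω ≠ 0} :=
    (measurableSet_eq_fun (hm.const_mul (v ((t : ℝ) / n))) measurable_const).compl
  exact Measurable.ite hset measurable_const measurable_const

theorem measurableSet_aproc_mul (v : ℝ → ℝ) (ε : ℕ → ℕ → Ω → ℝ) {n t u : ℕ}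
    {m : MeasurableSpace Ω} (ht : Measurable[m] (ε n t)) (hu : Measurable[m] (ε n u)) :
    MeasurableSet[m] {ω | aproc v ε n t ω * aproc v ε n u ω = 1} :=
  measurableSet_eq_fun ((measurable_aproc v ε ht).mul (measurable_aproc v ε hu)) measurable_const

theorem aproc_mul_eq_indicator (v : ℝ → ℝ) (ε : ℕ → ℕ → Ω → ℝ) (n t u : ℕ) (ω : Ω) :
    aproc v ε n t ω * aproc v ε n u ω
      = {ω | aproc v ε n t ω * aproc v ε n u ω = 1}.indicator (fun _ => (1 : ℝ)) ω := by
  by_cases h1 : rproc v ε n t ω = 0 <;> by_cases h2 : rproc v ε n u ω = 0 <;>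
    simp [aproc, h1, h2, indicator]

theorem phat_eq_phat2 (v : ℝ → ℝ) (ε : ℕ → ℕ → Ω → ℝ) (K : ℝ → ℝ) (b : ℕ → ℝ) (n t : ℕ)
    (ω : Ω) : phat v ε K b n t ω = phat2 v ε K b n 0 t ω := by
  refine Finset.sum_congr rfl fun j _ => ?_
  rw [Nat.sub_zero]
  congr 1
  unfold aproc
  split_ifs <;> simp

theorem aproc_nonneg (v : ℝ → ℝ) (ε : ℕ → ℕ → Ω → ℝ) (n t : ℕ) (ω : Ω) :
    0 ≤ aproc v ε n t ω := by
  unfold aproc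
  split_ifs <;> norm_num

theorem aproc_le_one (v : ℝ → ℝ) (ε : ℕ → ℕ → Ω → ℝ) (n t : ℕ) (ω : Ω) :
    aproc v ε n t ω ≤ 1 := by
  unfold aproc
  split_ifs <;> norm_num

theorem natCast_div_mem_Ioc {n t : ℕ} (h1 : 1 ≤ t) (h2 : t ≤ n) :
    (t : ℝ) / n ∈ Ioc (0 : ℝ) 1 := by
  have ht : (0 : ℝ) < t := by exact_mod_cast h1
  have htn : (t : ℝ) ≤ n := by exact_mod_cast h2
  exact ⟨div_pos ht (ht.trans_le htn), div_le_one_of_le₀ htn (ht.trans_le htn).le⟩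

theorem tendsto_ceil_mul_div {s : ℝ} (hs : 0 ≤ s) :
    Tendsto (fun n : ℕ => (⌈(n : ℝ) * s⌉₊ : ℝ) / n) atTop (nhds s) := by
  have := (tendsto_nat_ceil_mul_div_atTop hs).comp (tendsto_natCast_atTop_atTop (R := ℝ))
  simpa [Function.comp_def, mul_comm] using this

theorem tendsto_mul_bandwidth {b : ℕ → ℝ} (hb_pos : ∀ n, 0 < b n)
    (hb0 : Tendsto b atTop (nhds 0))
    (hnb : Tendsto (fun n : ℕ => 1 / ((n : ℝ) * (b n) ^ 2)) atTop (nhds 0)) :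
    Tendsto (fun n : ℕ => (n : ℝ) * b n) atTop atTop := by
  have h1 : Tendsto (fun n : ℕ => (n : ℝ) * (b n) ^ 2) atTop atTop := by
    have h2 : Tendsto (fun n : ℕ => 1 / ((n : ℝ) * (b n) ^ 2)) atTop (nhdsWithin 0 (Ioi 0)) := by
      refine tendsto_nhdsWithin_iff.2 ⟨hnb, ?_⟩
      filter_upwards [eventually_gt_atTop 0] with n hn
      have := hb_pos n
      have hn' : (0 : ℝ) < n := by exact_mod_cast hn
      exact mem_Ioi.2 (by positivity)
    simpa [Function.comp_def] using tendsto_inv_nhdsGT_zero.comp h2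
  refine tendsto_atTop_mono' _ ?_ h1
  filter_upwards [hb0.eventually (gt_mem_nhds one_pos)] with n hn
  have := hb_pos n
  have : (b n) ^ 2 ≤ b n := by nlinarith
  gcongr

section Kernel

variable {K : ℝ → ℝ} {b : ℕ → ℝ}

theorem Kw_nonneg (hK : ∀ z, 0 ≤ K z) (n t i : ℕ) : 0 ≤ Kw K b n t i := by
  unfold Kw
  split_ifs
  · exact le_rfl
  · exact hK _

theorem tendsto_sum_Kw (hK_cont : Continuous K) (hK_nonneg : ∀ z, 0 ≤ K z)
    (hK_int : ∫ z : ℝ, K z = 1) (hb_pos : ∀ n, 0 < b n) (hb0 : Tendsto b atTop (nhds 0))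
    (hnb : Tendsto (fun n : ℕ => (n : ℝ) * b n) atTop atTop) {s : ℝ} (hs : s ∈ Ioo (0 : ℝ) 1) :
    Tendsto (fun n : ℕ => ∑ i ∈ Finset.Icc 1 n, Kw K b n ⌈(n : ℝ) * s⌉₊ i) atTop atTop := by
  obtain ⟨z, hz⟩ : ∃ z, 0 < K z := by
    by_contra! hcon
    have : K = fun _ => 0 := funext fun z => le_antisymm (hcon z) (hK_nonneg z)
    rw [this] at hK_int
    simp at hK_int
  obtain ⟨η, hη, hKη⟩ := Metric.continuousAt_iff.1 hK_cont.continuousAt (K z / 2) (half_pos hz)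
  set δ := η / 2 with hδ
  have hδ0 : 0 < δ := half_pos hη
  have hKδ : ∀ y, |y - z| ≤ δ → K z / 2 ≤ K y := by
    intro y hy
    have := hKη (x := y) (by rw [Real.dist_eq]; linarith)
    rw [Real.dist_eq, abs_lt] at this
    linarith
  have hlo : Tendsto (fun n : ℕ => (⌈(n : ℝ) * s⌉₊ : ℝ) / n - (z + δ) * b n) atTop (nhds s) := by
    simpa using (tendsto_ceil_mul_div hs.1.le).sub (hb0.const_mul (z + δ))
  have hhi : Tendsto (fun n : ℕ => (⌈(n : ℝ) * s⌉₊ : ℝ) / n - (z - δ) * b n) atTop (nhds s) := by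
    simpa using (tendsto_ceil_mul_div hs.1.le).sub (hb0.const_mul (z - δ))
  have hbig : Tendsto (fun n : ℕ => (2 * δ * ((n : ℝ) * b n) - 2) * (K z / 2)) atTop atTop :=
    (tendsto_atTop_add_const_right _ _ (hnb.const_mul_atTop (by positivity))).atTop_mul_const
      (by positivity)
  refine tendsto_atTop_mono' _ ?_ hbig
  filter_upwards [hlo.eventually (lt_mem_nhds hs.1), hhi.eventually (gt_mem_nhds hs.2),
    eventually_gt_atTop 0] with n hnlo hnhi hn
  have hn' : (0 : ℝ) < n := by exact_mod_cast hn
  have hN : 0 < (n : ℝ) * b n := mul_pos hn' (hb_pos n)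
  set N := (n : ℝ) * b n with hNdef
  set t := ⌈(n : ℝ) * s⌉₊
  set lo := (t : ℝ) - (z + δ) * N with hlodef
  set hi := (t : ℝ) - (z - δ) * N with hhidef
  have hlo0 : 0 < lo := by
    have : lo = n * ((t : ℝ) / n - (z + δ) * b n) := by
      rw [hlodef, hNdef]; field_simp
    rw [this]
    exact mul_pos hn' hnlo
  have hhin : hi < n := by
    have : hi = n * ((t : ℝ) / n - (z - δ) * b n) := by
      rw [hhidef, hNdef]; field_simp
    rw [this]
    nlinarith
  have hlohi : lo ≤ hi := by rw [hlodef, hhidef]; nlinarith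
  set T := (Finset.Icc ⌈lo⌉₊ ⌊hi⌋₊).erase t with hT
  have hTsub : T ⊆ Finset.Icc 1 n := by
    intro i hi'
    have hi'' := Finset.mem_Icc.1 (Finset.mem_of_mem_erase hi')
    refine Finset.mem_Icc.2 ⟨(Nat.one_le_ceil_iff.2 hlo0).trans hi''.1, hi''.2.trans ?_⟩
    exact Nat.floor_le_of_le hhin.le
  have hTK : ∀ i ∈ T, K z / 2 ≤ Kw K b n t i := by
    intro i hi'
    have hne := Finset.ne_of_mem_erase hi'
    have hi'' := Finset.mem_Icc.1 (Finset.mem_of_mem_erase hi')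
    have h1 : lo ≤ i := Nat.ceil_le.1 hi''.1
    have h2 : (i : ℝ) ≤ hi := (Nat.le_floor_iff (hlo0.le.trans hlohi)).1 hi''.2
    rw [Kw, if_neg hne.symm]
    refine hKδ _ ?_
    rw [div_sub' hN.ne', abs_div, abs_of_pos hN, div_le_iff₀ hN, abs_le]
    constructor <;> linarith
  have hcard : 2 * δ * N - 2 ≤ (T.card : ℝ) := by
    have h1 : (Finset.Icc ⌈lo⌉₊ ⌊hi⌋₊).card - 1 ≤ T.card := Finset.pred_card_le_card_erase
    rw [Nat.card_Icc] at h1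
    have h2 : ⌊hi⌋₊ ≤ T.card + ⌈lo⌉₊ := by omega
    have h3 : (⌊hi⌋₊ : ℝ) ≤ T.card + ⌈lo⌉₊ := by exact_mod_cast h2
    have h4 := Nat.lt_floor_add_one hi
    have h5 := Nat.ceil_lt_add_one hlo0.le
    linarith
  calc (2 * δ * N - 2) * (K z / 2) ≤ T.card * (K z / 2) := by gcongr
    _ = ∑ i ∈ T, K z / 2 := by rw [Finset.sum_const, nsmul_eq_mul]
    _ ≤ ∑ i ∈ T, Kw K b n t i := Finset.sum_le_sum hTK
    _ ≤ ∑ i ∈ Finset.Icc 1 n, Kw K b n t i :=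
        Finset.sum_le_sum_of_subset_of_nonneg hTsub fun i _ _ => Kw_nonneg hK_nonneg n t i

theorem eventually_wgt_local (hK_supp : HasCompactSupport K) (hb_pos : ∀ n, 0 < b n)
    (hb0 : Tendsto b atTop (nhds 0)) {s η : ℝ} (hs : 0 ≤ s) (hη : 0 < η) :
    ∀ᶠ n : ℕ in atTop, ∀ j : ℕ, wgt K b n ⌈(n : ℝ) * s⌉₊ j ≠ 0 → |(j : ℝ) / n - s| < η := by
  obtain ⟨C, hC⟩ := hK_supp.isCompact.isBounded.exists_norm_le
  have hCb : Tendsto (fun n : ℕ => C * b n) atTop (nhds 0) := by simpa using hb0.const_mul C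
  filter_upwards [hCb.eventually (gt_mem_nhds (half_pos hη)), eventually_gt_atTop 0,
    (Metric.tendsto_nhds.1 (tendsto_ceil_mul_div hs)) (η / 2) (half_pos hη)] with n h1 hn h2 j hj
  have hn' : (0 : ℝ) < n := by exact_mod_cast hn
  have hN : 0 < (n : ℝ) * b n := mul_pos hn' (hb_pos n)
  set t := ⌈(n : ℝ) * s⌉₊
  have hK : K (((t : ℝ) - j) / (n * b n)) ≠ 0 := by
    intro h0
    apply hj
    simp [wgt, Kw, h0]
  have h3 := hC _ (subset_tsupport K (Function.mem_support.2 hK))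
  rw [Real.norm_eq_abs, abs_div, abs_of_pos hN, div_le_iff₀ hN] at h3
  have h4 : |(t : ℝ) / n - (j : ℝ) / n| ≤ C * b n := by
    rw [← sub_div, abs_div, abs_of_pos hn', div_le_iff₀ hn']
    linarith
  rw [Real.dist_eq] at h2
  calc |(j : ℝ) / n - s| ≤ |(j : ℝ) / n - (t : ℝ) / n| + |(t : ℝ) / n - s| := abs_sub_le _ _ _
    _ < η := by rw [abs_sub_comm ((j : ℝ) / n)]; linarith

theorem wgt_nonneg (hK : ∀ z, 0 ≤ K z) (n t i : ℕ) : 0 ≤ wgt K b n t i :=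
  div_nonneg (Kw_nonneg hK n t i) (Finset.sum_nonneg fun i _ => Kw_nonneg hK n t i)

theorem sum_wgt_le_one (n h t : ℕ) (hK : ∀ z, 0 ≤ K z) :
    ∑ j ∈ Finset.Icc (h + 1) n, wgt K b n t j ≤ 1 := by
  calc ∑ j ∈ Finset.Icc (h + 1) n, wgt K b n t j ≤ ∑ j ∈ Finset.Icc 1 n, wgt K b n t j :=
        Finset.sum_le_sum_of_subset_of_nonneg (Finset.Icc_subset_Icc (by omega) le_rfl)
          fun i _ _ => wgt_nonneg hK n t i
    _ ≤ 1 := by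
        simp only [wgt]
        rw [← Finset.sum_div]
        exact div_self_le_one _

theorem tendsto_sum_wgt_mul (hK_supp : HasCompactSupport K) (hK_nonneg : ∀ z, 0 ≤ K z)
    (hb_pos : ∀ n, 0 < b n) (hb0 : Tendsto b atTop (nhds 0)) {s : ℝ} (hs : 0 < s)
    (hS : Tendsto (fun n : ℕ => ∑ i ∈ Finset.Icc 1 n, Kw K b n ⌈(n : ℝ) * s⌉₊ i) atTop atTop)
    {f : ℝ → ℝ} (hf : ContinuousAt f s) (h : ℕ) :
    Tendsto (fun n : ℕ => ∑ j ∈ Finset.Icc (h + 1) n,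
      wgt K b n ⌈(n : ℝ) * s⌉₊ j * f ((j : ℝ) / n)) atTop (nhds (f s)) := by
  rw [Metric.tendsto_nhds]
  intro e he
  obtain ⟨η, hη, hfη⟩ := Metric.continuousAt_iff.1 hf (e / 2) (half_pos he)
  have hη' : 0 < min η (s / 2) := lt_min hη (half_pos hs)
  have hhn : Tendsto (fun n : ℕ => (h : ℝ) / n) atTop (nhds 0) :=
    tendsto_const_div_atTop_nhds_zero_nat _
  filter_upwards [eventually_wgt_local hK_supp hb_pos hb0 hs.le hη',
    hhn.eventually (gt_mem_nhds (half_pos hs)), hS.eventually_gt_atTop 0] with n hloc hhs hpos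
  set t := ⌈(n : ℝ) * s⌉₊
  have hext : ∑ j ∈ Finset.Icc (h + 1) n, wgt K b n t j * f ((j : ℝ) / n)
      = ∑ j ∈ Finset.Icc 1 n, wgt K b n t j * f ((j : ℝ) / n) := by
    refine Finset.sum_subset (Finset.Icc_subset_Icc (by omega) le_rfl) fun j hj hj' => ?_
    rw [Finset.mem_Icc] at hj hj'
    have hjh : j ≤ h := by omega
    by_contra hne
    have h1 := (hloc j (left_ne_zero_of_mul hne)).trans_le (min_le_right _ _)
    have h2 : (j : ℝ) / n ≤ (h : ℝ) / n := by gcongr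
    rw [abs_lt] at h1
    linarith
  have hone : ∑ j ∈ Finset.Icc 1 n, wgt K b n t j = 1 := by
    simp only [wgt]
    rw [← Finset.sum_div]
    exact div_self hpos.ne'
  have hdiff : ∑ j ∈ Finset.Icc 1 n, wgt K b n t j * f ((j : ℝ) / n) - f s
      = ∑ j ∈ Finset.Icc 1 n, wgt K b n t j * (f ((j : ℝ) / n) - f s) := by
    simp only [mul_sub, Finset.sum_sub_distrib]
    rw [← Finset.sum_mul, hone, one_mul]
  rw [Real.dist_eq, hext, hdiff]
  calc |∑ j ∈ Finset.Icc 1 n, wgt K b n t j * (f ((j : ℝ) / n) - f s)|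
      ≤ ∑ j ∈ Finset.Icc 1 n, |wgt K b n t j * (f ((j : ℝ) / n) - f s)| :=
        Finset.abs_sum_le_sum_abs _ _
    _ ≤ ∑ j ∈ Finset.Icc 1 n, wgt K b n t j * (e / 2) := by
        refine Finset.sum_le_sum fun j _ => ?_
        rw [abs_mul, abs_of_nonneg (wgt_nonneg hK_nonneg n t j)]
        by_cases hw : wgt K b n t j = 0
        · simp [hw]
        · have h1 := (hloc j hw).trans_le (min_le_left _ _)
          have h2 := hfη (x := (j : ℝ) / n) (by rwa [Real.dist_eq])
          rw [Real.dist_eq] at h2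
          exact mul_le_mul_of_nonneg_left h2.le (wgt_nonneg hK_nonneg n t j)
    _ = e / 2 := by rw [← Finset.sum_mul, hone, one_mul]
    _ < e := half_lt_self he

variable {v : ℝ → ℝ} {ε : ℕ → ℕ → Ω → ℝ}

theorem phat2_nonneg (hK : ∀ z, 0 ≤ K z) (n h t : ℕ) (ω : Ω) : 0 ≤ phat2 v ε K b n h t ω :=
  Finset.sum_nonneg fun j _ => mul_nonneg (wgt_nonneg hK n t j)
    (mul_nonneg (aproc_nonneg v ε n j ω) (aproc_nonneg v ε n (j - h) ω))

theorem phat2_le_phat (hK : ∀ z, 0 ≤ K z) (n h t : ℕ) (ω : Ω) :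
    phat2 v ε K b n h t ω ≤ phat v ε K b n t ω := by
  calc phat2 v ε K b n h t ω
      ≤ ∑ j ∈ Finset.Icc (h + 1) n, wgt K b n t j * aproc v ε n j ω :=
        Finset.sum_le_sum fun j _ => mul_le_mul_of_nonneg_left
          (mul_le_of_le_one_right (aproc_nonneg v ε n j ω) (aproc_le_one v ε n (j - h) ω))
          (wgt_nonneg hK n t j)
    _ ≤ phat v ε K b n t ω :=
        Finset.sum_le_sum_of_subset_of_nonneg (Finset.Icc_subset_Icc (by omega) le_rfl)
          fun j _ _ => mul_nonneg (wgt_nonneg hK n t j) (aproc_nonneg v ε n j ω)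

theorem phat2_le_one (hK : ∀ z, 0 ≤ K z) (n h t : ℕ) (ω : Ω) : phat2 v ε K b n h t ω ≤ 1 := by
  refine le_trans (Finset.sum_le_sum fun j _ => ?_) (sum_wgt_le_one (b := b) n h t hK)
  exact mul_le_of_le_one_right (wgt_nonneg hK n t j) (mul_le_one₀ (aproc_le_one v ε n j ω)
    (aproc_nonneg v ε n (j - h) ω) (aproc_le_one v ε n (j - h) ω))

/-- The estimator `p̂_{t,t-h} / p̂_t`, set to zero where `p̂_t = 0`. -/
noncomputable def phatRatio (v : ℝ → ℝ) (ε : ℕ → ℕ → Ω → ℝ) (K : ℝ → ℝ) (b : ℕ → ℝ)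
    (n h t : ℕ) (ω : Ω) : ℝ :=
  if phat v ε K b n t ω = 0 then 0 else phat2 v ε K b n h t ω / phat v ε K b n t ω

theorem phatRatio_nonneg (hK : ∀ z, 0 ≤ K z) (n h t : ℕ) (ω : Ω) :
    0 ≤ phatRatio v ε K b n h t ω := by
  unfold phatRatio
  split_ifs
  · exact le_rfl
  · exact div_nonneg (phat2_nonneg hK n h t ω)
      ((phat2_nonneg hK n h t ω).trans (phat2_le_phat hK n h t ω))

theorem phatRatio_le_one (hK : ∀ z, 0 ≤ K z) (n h t : ℕ) (ω : Ω) :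
    phatRatio v ε K b n h t ω ≤ 1 := by
  unfold phatRatio
  split_ifs
  · exact zero_le_one
  · exact div_le_one_of_le₀ (phat2_le_phat hK n h t ω)
      ((phat2_nonneg hK n h t ω).trans (phat2_le_phat hK n h t ω))

theorem abs_phatRatio_sub_le (hK : ∀ z, 0 ≤ K z) (n h t : ℕ) (ω : Ω) {x y : ℝ} (hx : 0 < x) :
    |phatRatio v ε K b n h t ω - y / x|
      ≤ x⁻¹ * (|phat2 v ε K b n 0 t ω - x| + |phat2 v ε K b n h t ω - y|) := by
  have hmul : phatRatio v ε K b n h t ω * phat2 v ε K b n 0 t ω = phat2 v ε K b n h t ω := by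
    rw [← phat_eq_phat2]
    unfold phatRatio
    split_ifs with h0
    · rw [zero_mul]
      exact le_antisymm (phat2_nonneg hK n h t ω) (h0 ▸ phat2_le_phat hK n h t ω)
    · exact div_mul_cancel₀ _ h0
  have h0 := phatRatio_nonneg (v := v) (ε := ε) (b := b) hK n h t ω
  have h1 := phatRatio_le_one (v := v) (ε := ε) (b := b) hK n h t ω
  generalize phatRatio v ε K b n h t ω = ρ at *
  have heq : ρ - y / x = x⁻¹ * (ρ * (x - phat2 v ε K b n 0 t ω)
      + (phat2 v ε K b n h t ω - y)) := by
    rw [← hmul]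
    field_simp
    ring
  rw [heq, abs_mul, abs_of_pos (inv_pos.2 hx)]
  gcongr
  refine (abs_add_le _ _).trans (add_le_add ?_ le_rfl)
  rw [abs_mul, abs_of_nonneg h0, abs_sub_comm x]
  exact mul_le_of_le_one_left (abs_nonneg _) h1

end Kernel

variable [MeasurableSpace Ω]

/-- An `L¹` weak law for weighted sums of weakly dependent events. -/
theorem integral_abs_weighted_indicator_le (μ : Measure Ω) [IsProbabilityMeasure μ]
    (J : Finset ℕ) {B : ℕ → Set Ω} (hB : ∀ j ∈ J, MeasurableSet (B j)) {β : ℕ → ℝ}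
    (hβ : Summable β) (hβ0 : ∀ k, 0 ≤ β k)
    (hcov : ∀ i ∈ J, ∀ j ∈ J, i ≤ j →
      |μ.real (B i ∩ B j) - μ.real (B i) * μ.real (B j)| ≤ β (j - i))
    {w : ℕ → ℝ} {W L : ℝ} (hw : ∀ j ∈ J, |w j| ≤ W) (hL : ∑ j ∈ J, |w j| ≤ L) (hW : 0 ≤ W) :
    ∫ ω, |∑ j ∈ J, w j * ((B j).indicator (fun _ => (1 : ℝ)) ω - μ.real (B j))| ∂μ
      ≤ √(2 * W * L * ∑' k, β k) := by
  set Z : ℕ → Ω → ℝ := fun j ω => (B j).indicator (fun _ => (1 : ℝ)) ω - μ.real (B j) with hZ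
  have hZm : ∀ j ∈ J, Measurable (Z j) := fun j hj =>
    (measurable_const.indicator (hB j hj)).sub_const _
  have hZb : ∀ j ω, |Z j ω| ≤ 1 := by
    intro j ω
    have h1 : μ.real (B j) ≤ 1 := measureReal_le_one
    have h0 : 0 ≤ μ.real (B j) := measureReal_nonneg
    simp only [hZ, indicator]
    split_ifs <;> rw [abs_le] <;> constructor <;> linarith
  have hbddint : ∀ (f : Ω → ℝ) (c : ℝ), Measurable f → (∀ ω, |f ω| ≤ c) → Integrable f μ :=
    fun f c hf hc => Integrable.of_bound hf.aestronglyMeasurable c (Eventually.of_forall hc)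
  have hcross : ∀ i ∈ J, ∀ j ∈ J, ∫ ω, Z i ω * Z j ω ∂μ
      = μ.real (B i ∩ B j) - μ.real (B i) * μ.real (B j) := by
    intro i hi j hj
    have hii : Integrable (fun ω => (B i).indicator (fun _ => (1 : ℝ)) ω) μ :=
      (integrable_const _).indicator (hB i hi)
    have hij : Integrable (fun ω => (B j).indicator (fun _ => (1 : ℝ)) ω) μ :=
      (integrable_const _).indicator (hB j hj)
    have hiij : Integrable (fun ω => (B i ∩ B j).indicator (fun _ => (1 : ℝ)) ω) μ :=
      (integrable_const _).indicator ((hB i hi).inter (hB j hj))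
    have hexp : ∀ ω, Z i ω * Z j ω = (B i ∩ B j).indicator (fun _ => (1 : ℝ)) ω
        - μ.real (B j) * (B i).indicator (fun _ => (1 : ℝ)) ω
        - μ.real (B i) * (B j).indicator (fun _ => (1 : ℝ)) ω
        + μ.real (B i) * μ.real (B j) := by
      intro ω
      have hprod : (B i ∩ B j).indicator (fun _ => (1 : ℝ)) ω
          = (B i).indicator (fun _ => (1 : ℝ)) ω * (B j).indicator (fun _ => (1 : ℝ)) ω := by
        by_cases h1 : ω ∈ B i <;> by_cases h2 : ω ∈ B j <;> simp [h1, h2]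
      rw [hprod]
      simp only [hZ]
      ring
    have hd1 : Integrable (fun ω => (B i ∩ B j).indicator (fun _ => (1 : ℝ)) ω
        - μ.real (B j) * (B i).indicator (fun _ => (1 : ℝ)) ω) μ := hiij.sub (hii.const_mul _)
    have hd2 : Integrable (fun ω => (B i ∩ B j).indicator (fun _ => (1 : ℝ)) ω
        - μ.real (B j) * (B i).indicator (fun _ => (1 : ℝ)) ω
        - μ.real (B i) * (B j).indicator (fun _ => (1 : ℝ)) ω) μ := hd1.sub (hij.const_mul _)
    simp only [hexp]
    rw [integral_add hd2 (integrable_const _), integral_sub hd1 (hij.const_mul _),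
      integral_sub hiij (hii.const_mul _), integral_const_mul, integral_const_mul,
      integral_indicator_const _ (hB i hi), integral_indicator_const _ (hB j hj),
      integral_indicator_const _ ((hB i hi).inter (hB j hj))]
    simp
    ring
  have hcrossle : ∀ i ∈ J, ∀ j ∈ J, |∫ ω, Z i ω * Z j ω ∂μ| ≤ β (Nat.dist i j) := by
    intro i hi j hj
    rw [hcross i hi j hj]
    rcases le_total i j with hij | hij
    · rw [Nat.dist_eq_sub_of_le hij]
      exact hcov i hi j hj hij
    · rw [inter_comm, mul_comm, Nat.dist_eq_sub_of_le_right hij]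
      exact hcov j hj i hi hij
  set Y : Ω → ℝ := fun ω => ∑ j ∈ J, w j * Z j ω with hY
  have hYm : Measurable Y := Finset.measurable_fun_sum _ fun j hj => (hZm j hj).const_mul _
  have hYb : ∀ ω, |Y ω| ≤ ∑ j ∈ J, |w j| := by
    intro ω
    refine (Finset.abs_sum_le_sum_abs _ _).trans (Finset.sum_le_sum fun j _ => ?_)
    rw [abs_mul]
    exact mul_le_of_le_one_right (abs_nonneg _) (hZb j ω)
  have hLp : MemLp Y 2 μ :=
    MemLp.of_bound hYm.aestronglyMeasurable _ (Eventually.of_forall hYb)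
  have hsumβ : ∀ i, ∑ j ∈ J, β (Nat.dist i j) ≤ 2 * ∑' k, β k := by
    intro i
    have hpart : ∀ S : Finset ℕ, Set.InjOn (Nat.dist i) S →
        ∑ j ∈ S, β (Nat.dist i j) ≤ ∑' k, β k := by
      intro S hS
      rw [← Finset.sum_image (f := β) hS]
      exact hβ.sum_le_tsum _ fun k _ => hβ0 k
    rw [← Finset.sum_filter_add_sum_filter_not J (fun j => i ≤ j), two_mul]
    refine add_le_add (hpart _ ?_) (hpart _ ?_)
    · intro x hx y hy hxy
      simp only [Finset.coe_filter, mem_ofPred_eq] at hx hy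
      simp only [Nat.dist] at hxy
      omega
    · intro x hx y hy hxy
      simp only [Finset.coe_filter, mem_ofPred_eq] at hx hy
      simp only [Nat.dist] at hxy
      omega
  have hL0 : 0 ≤ L := (Finset.sum_nonneg fun j _ => abs_nonneg (w j)).trans hL
  have hS0 : 0 ≤ ∑' k, β k := tsum_nonneg hβ0
  have hsq : ∫ ω, Y ω ^ 2 ∂μ ≤ 2 * W * L * ∑' k, β k := by
    have hexp : ∀ ω, Y ω ^ 2 = ∑ i ∈ J, ∑ j ∈ J, w i * w j * (Z i ω * Z j ω) := by
      intro ω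
      rw [sq, hY, Finset.sum_mul_sum]
      exact Finset.sum_congr rfl fun i _ => Finset.sum_congr rfl fun j _ => by ring
    have hZZ : ∀ i ∈ J, ∀ j ∈ J, Integrable (fun ω => w i * w j * (Z i ω * Z j ω)) μ :=
      fun i hi j hj => (hbddint _ 1 ((hZm i hi).mul (hZm j hj)) fun ω => by
        rw [Pi.mul_apply, abs_mul]
        exact mul_le_one₀ (hZb i ω) (abs_nonneg _) (hZb j ω)).const_mul _
    simp only [hexp]
    rw [integral_finsetSum _ fun i hi => integrable_finsetSum _ fun j hj => hZZ i hi j hj]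
    calc ∑ i ∈ J, ∫ ω, ∑ j ∈ J, w i * w j * (Z i ω * Z j ω) ∂μ
        = ∑ i ∈ J, ∑ j ∈ J, w i * w j * ∫ ω, Z i ω * Z j ω ∂μ := by
          refine Finset.sum_congr rfl fun i hi => ?_
          rw [integral_finsetSum _ fun j hj => hZZ i hi j hj]
          exact Finset.sum_congr rfl fun j _ => integral_const_mul _ _
      _ ≤ ∑ i ∈ J, ∑ j ∈ J, |w i| * W * β (Nat.dist i j) := by
          refine Finset.sum_le_sum fun i hi => Finset.sum_le_sum fun j hj => ?_
          refine (le_abs_self _).trans ?_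
          rw [abs_mul, abs_mul]
          have := hcrossle i hi j hj
          have := hw j hj
          gcongr
      _ = ∑ i ∈ J, |w i| * (W * ∑ j ∈ J, β (Nat.dist i j)) := by
          simp only [Finset.mul_sum, mul_assoc]
      _ ≤ ∑ i ∈ J, |w i| * (W * (2 * ∑' k, β k)) := by
          refine Finset.sum_le_sum fun i _ => ?_
          have := hsumβ i
          gcongr
      _ = (∑ i ∈ J, |w i|) * (W * (2 * ∑' k, β k)) := by rw [Finset.sum_mul]
      _ ≤ L * (W * (2 * ∑' k, β k)) := by gcongr
      _ = 2 * W * L * ∑' k, β k := by ring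
  have hjensen : (∫ ω, |Y ω| ∂μ) ^ 2 ≤ ∫ ω, Y ω ^ 2 ∂μ := by
    have := variance_nonneg |Y| μ
    rw [variance_eq_sub hLp.abs] at this
    simpa [Pi.pow_apply] using this
  exact Real.le_sqrt_of_sq_le (hjensen.trans hsq)

theorem abs_measureReal_sub_mul_le_one (μ : Measure Ω) [IsProbabilityMeasure μ] (A B : Set Ω) :
    |(μ (A ∩ B)).toReal - (μ A).toReal * (μ B).toReal| ≤ 1 := by
  have h1 : 0 ≤ μ.real (A ∩ B) := measureReal_nonneg
  have h2 : μ.real (A ∩ B) ≤ 1 := measureReal_le_one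
  have h3 : 0 ≤ μ.real A * μ.real B := mul_nonneg measureReal_nonneg measureReal_nonneg
  have h4 : μ.real A * μ.real B ≤ 1 :=
    mul_le_one₀ measureReal_le_one measureReal_nonneg measureReal_le_one
  change |μ.real (A ∩ B) - μ.real A * μ.real B| ≤ 1
  rw [abs_le]
  constructor <;> linarith

theorem bddAbove_mixing (μ : Measure Ω) [IsProbabilityMeasure μ] (ε : ℕ → ℕ → Ω → ℝ)
    (n t h : ℕ) : BddAbove {x : ℝ | ∃ A B : Set Ω,
      MeasurableSet[pastField ε n t] A ∧ MeasurableSet[futureField ε n (t + h)] B ∧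
      x = |(μ (A ∩ B)).toReal - (μ A).toReal * (μ B).toReal|} := by
  refine ⟨1, ?_⟩
  rintro x ⟨A, B, -, -, rfl⟩
  exact abs_measureReal_sub_mul_le_one μ A B

theorem sSup_mixing_le_one (μ : Measure Ω) [IsProbabilityMeasure μ] (ε : ℕ → ℕ → Ω → ℝ)
    (n t h : ℕ) : sSup {x : ℝ | ∃ A B : Set Ω,
      MeasurableSet[pastField ε n t] A ∧ MeasurableSet[futureField ε n (t + h)] B ∧
      x = |(μ (A ∩ B)).toReal - (μ A).toReal * (μ B).toReal|} ≤ 1 := by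
  refine Real.sSup_le ?_ zero_le_one
  rintro x ⟨A, B, -, -, rfl⟩
  exact abs_measureReal_sub_mul_le_one μ A B

theorem alphaMix_le_one (μ : Measure Ω) [IsProbabilityMeasure μ] (ε : ℕ → ℕ → Ω → ℝ) (h : ℕ) :
    alphaMix μ ε h ≤ 1 :=
  ciSup_le fun n => ciSup_le fun t => sSup_mixing_le_one μ ε n t h

theorem abs_cov_le_alphaMix (μ : Measure Ω) [IsProbabilityMeasure μ] (ε : ℕ → ℕ → Ω → ℝ)
    {n t h : ℕ} {A B : Set Ω} (hA : MeasurableSet[pastField ε n t] A)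
    (hB : MeasurableSet[futureField ε n (t + h)] B) :
    |μ.real (A ∩ B) - μ.real A * μ.real B| ≤ alphaMix μ ε h := by
  refine (le_csSup (bddAbove_mixing μ ε n t h) ⟨A, B, hA, hB, rfl⟩).trans ?_
  refine le_trans ?_ (le_ciSup (f := fun n : ℕ => ⨆ t : ℕ, sSup {x : ℝ | ∃ A B : Set Ω,
    MeasurableSet[pastField ε n t] A ∧ MeasurableSet[futureField ε n (t + h)] B ∧
    x = |(μ (A ∩ B)).toReal - (μ A).toReal * (μ B).toReal|}) ⟨1, ?_⟩ n)
  · refine le_ciSup (f := fun t : ℕ => sSup {x : ℝ | ∃ A B : Set Ω,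
      MeasurableSet[pastField ε n t] A ∧ MeasurableSet[futureField ε n (t + h)] B ∧
      x = |(μ (A ∩ B)).toReal - (μ A).toReal * (μ B).toReal|}) ⟨1, ?_⟩ t
    rintro _ ⟨t, rfl⟩
    exact sSup_mixing_le_one μ ε n t h
  · rintro _ ⟨n, rfl⟩
    exact ciSup_le fun t => sSup_mixing_le_one μ ε n t h

theorem alphaMix_nonneg (μ : Measure Ω) [IsProbabilityMeasure μ] (ε : ℕ → ℕ → Ω → ℝ) (h : ℕ) :
    0 ≤ alphaMix μ ε h :=
  (abs_nonneg _).trans (abs_cov_le_alphaMix μ ε (n := 0) (t := 0)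
    (@MeasurableSet.empty _ (pastField ε 0 0)) (@MeasurableSet.empty _ (futureField ε 0 (0 + h))))

theorem summable_alphaMix (μ : Measure Ω) [IsProbabilityMeasure μ] (ε : ℕ → ℕ → Ω → ℝ) {θ : ℝ}
    (hθ : θ ≤ 1) (hmix : Summable (fun h : ℕ => alphaMix μ ε h ^ θ)) :
    Summable (alphaMix μ ε) := by
  refine Summable.of_nonneg_of_le (alphaMix_nonneg μ ε) (fun h => ?_) hmix
  exact Real.self_le_rpow_of_le_one (alphaMix_nonneg μ ε h) (alphaMix_le_one μ ε h) hθ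

/-- Covariances of events that look back at most `h` steps are dominated by a summable function
of their lag. -/
theorem exists_summable_cov_bound (μ : Measure Ω) [IsProbabilityMeasure μ]
    (ε : ℕ → ℕ → Ω → ℝ) (hα : Summable (alphaMix μ ε)) (h : ℕ) :
    ∃ β : ℕ → ℝ, Summable β ∧ (∀ k, 0 ≤ β k) ∧ ∀ (n i j : ℕ) (A B : Set Ω), i ≤ j →
      MeasurableSet[pastField ε n i] A → MeasurableSet[futureField ε n (j - h)] B →
      |μ.real (A ∩ B) - μ.real A * μ.real B| ≤ β (j - i) := by
  refine ⟨fun k => if k ≤ h then 1 else alphaMix μ ε (k - h), ?_, fun k => ?_, ?_⟩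
  · rw [← summable_nat_add_iff (h + 1)]
    refine ((summable_nat_add_iff 1).2 hα).congr fun k => ?_
    rw [if_neg (by omega)]
    congr 1
    omega
  · dsimp only
    split_ifs
    · exact zero_le_one
    · exact alphaMix_nonneg μ ε _
  · intro n i j A B hij hA hB
    dsimp only
    split_ifs with hk
    · exact abs_measureReal_sub_mul_le_one μ A B
    · refine abs_cov_le_alphaMix μ ε hA ?_
      rwa [show i + (j - i - h) = j - h by omega]

theorem tendstoInMeasure_of_tendsto_integral_abs (μ : Measure Ω) [IsProbabilityMeasure μ]
    {X : ℕ → Ω → ℝ} {x : ℝ} (hint : ∀ n, Integrable (X n) μ)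
    (hlim : Tendsto (fun n => ∫ ω, |X n ω - x| ∂μ) atTop (nhds 0)) :
    TendstoInMeasure μ X atTop (fun _ => x) := by
  rw [tendstoInMeasure_iff_measureReal_norm]
  intro e he
  have hlim' : Tendsto (fun n => e⁻¹ * ∫ ω, |X n ω - x| ∂μ) atTop (nhds 0) := by
    simpa using hlim.const_mul e⁻¹
  refine squeeze_zero (fun _ => measureReal_nonneg) (fun n => ?_) hlim'
  have := mul_meas_ge_le_integral_of_nonneg (μ := μ) (f := fun ω => |X n ω - x|)
    (Eventually.of_forall fun _ => abs_nonneg _) ((hint n).sub (integrable_const x)).abs e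
  rw [inv_mul_eq_div, le_div_iff₀ he, mul_comm]
  exact this

theorem tendstoInMeasure_comp₂ (μ : Measure Ω) {X Y : ℕ → Ω → ℝ} {x y : ℝ} {F : ℝ → ℝ → ℝ}
    (hX : TendstoInMeasure μ X atTop (fun _ => x)) (hY : TendstoInMeasure μ Y atTop (fun _ => y))
    (hF : ContinuousAt (fun p : ℝ × ℝ => F p.1 p.2) (x, y)) :
    TendstoInMeasure μ (fun n ω => F (X n ω) (Y n ω)) atTop (fun _ => F x y) := by
  rw [tendstoInMeasure_iff_dist] at hX hY ⊢
  intro e he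
  obtain ⟨d, hd, hFd⟩ := Metric.continuousAt_iff.1 hF e he
  have hlim := (hX d hd).add (hY d hd)
  rw [add_zero] at hlim
  refine tendsto_of_tendsto_of_tendsto_of_le_of_le tendsto_const_nhds hlim
    (fun _ => zero_le) (fun n => ?_)
  refine (measure_mono ?_).trans (measure_union_le _ _)
  intro ω hω
  by_contra hcon
  simp only [mem_union, mem_ofPred_eq, not_or, not_le] at hcon hω
  have := hFd (x := (X n ω, Y n ω)) (by
    rw [Prod.dist_eq]
    exact max_lt hcon.1 hcon.2)
  exact absurd this (not_lt.2 hω)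

section Model

variable {μ : Measure Ω} {v : ℝ → ℝ} {ε : ℕ → ℕ → Ω → ℝ}

theorem abs_cov_aproc_mul_le {β : ℕ → ℝ} {h : ℕ}
    (hcov : ∀ (n i j : ℕ) (A B : Set Ω), i ≤ j →
      MeasurableSet[pastField ε n i] A → MeasurableSet[futureField ε n (j - h)] B →
      |μ.real (A ∩ B) - μ.real A * μ.real B| ≤ β (j - i)) {n i j : ℕ} (hij : i ≤ j) :
    |μ.real ({ω | aproc v ε n i ω * aproc v ε n (i - h) ω = 1} ∩
        {ω | aproc v ε n j ω * aproc v ε n (j - h) ω = 1})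
      - μ.real {ω | aproc v ε n i ω * aproc v ε n (i - h) ω = 1}
        * μ.real {ω | aproc v ε n j ω * aproc v ε n (j - h) ω = 1}| ≤ β (j - i) :=
  hcov n i j _ _ hij
    (measurableSet_aproc_mul v ε (measurable_of_le_pastField ε le_rfl)
      (measurable_of_le_pastField ε (Nat.sub_le i h)))
    (measurableSet_aproc_mul v ε (measurable_of_futureField_le ε (Nat.sub_le j h))
      (measurable_of_futureField_le ε le_rfl))

theorem integrable_rpow_of_lintegral_le {X : Ω → ℝ} (hX : Measurable X) {p M : ℝ}
    (hmom : ∫⁻ ω, ENNReal.ofReal (|X ω| ^ p) ∂μ ≤ ENNReal.ofReal M) :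
    Integrable (fun ω => |X ω| ^ p) μ ∧ ∫ ω, |X ω| ^ p ∂μ ≤ max M 0 := by
  have hm : Measurable (fun ω => |X ω| ^ p) := hX.abs.pow_const p
  have hnn : ∀ ω, 0 ≤ |X ω| ^ p := fun ω => Real.rpow_nonneg (abs_nonneg _) _
  refine ⟨⟨hm.aestronglyMeasurable, ?_⟩, ?_⟩
  · rw [hasFiniteIntegral_iff_ofReal (Eventually.of_forall hnn)]
    exact hmom.trans_lt ENNReal.ofReal_lt_top
  · rw [integral_eq_lintegral_of_nonneg_ae (Eventually.of_forall hnn) hm.aestronglyMeasurable,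
      ← ENNReal.toReal_ofReal']
    exact ENNReal.toReal_mono ENNReal.ofReal_ne_top hmom

theorem integrable_sq_tail {X : Ω → ℝ} (hX : Measurable X)
    (hint : Integrable (fun ω => X ω ^ 2) μ) (T : ℝ) :
    Integrable (fun ω => if T ≤ X ω ^ 2 then X ω ^ 2 else 0) μ :=
  hint.indicator (measurableSet_le measurable_const (hX.pow_const 2))

theorem sq_tail_le {x T ν : ℝ} (hT : 0 < T) (hν : 0 < ν) :
    (if T ≤ x ^ 2 then x ^ 2 else 0) ≤ |x| ^ (2 + 2 * ν) / T ^ ν := by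
  have hTν : 0 < T ^ ν := Real.rpow_pos_of_pos hT ν
  split_ifs with hx
  · have hx0 : 0 < |x| := by
      rw [abs_pos]
      rintro rfl
      norm_num at hx
      linarith
    rw [le_div_iff₀ hTν, Real.rpow_add hx0, Real.rpow_mul hx0.le, Real.rpow_two, sq_abs]
    gcongr
  · have : 0 ≤ |x| ^ (2 + 2 * ν) := Real.rpow_nonneg (abs_nonneg _) _
    positivity

/-- Bounded moments of order `2 + 2ν` make the squares uniformly integrable. -/
theorem exists_sq_tail_le {ν M : ℝ} (hν : 0 < ν) {e : ℝ} (he : 0 < e) :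
    ∃ T : ℝ, 0 < T ∧ ∀ X : Ω → ℝ, Measurable X →
      ∫⁻ ω, ENNReal.ofReal (|X ω| ^ (2 + 2 * ν)) ∂μ ≤ ENNReal.ofReal M →
      ∫ ω, (if T ≤ X ω ^ 2 then X ω ^ 2 else 0) ∂μ ≤ e := by
  obtain ⟨T, hTM, hT⟩ := (((tendsto_rpow_atTop hν).eventually_ge_atTop (max M 0 / e)).and
    (eventually_gt_atTop 0)).exists
  refine ⟨T, hT, fun X hX hmom => ?_⟩
  obtain ⟨hint, hle⟩ := integrable_rpow_of_lintegral_le hX hmom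
  have hTν : 0 < T ^ ν := Real.rpow_pos_of_pos hT ν
  calc ∫ ω, (if T ≤ X ω ^ 2 then X ω ^ 2 else 0) ∂μ
      ≤ ∫ ω, |X ω| ^ (2 + 2 * ν) / T ^ ν ∂μ :=
        integral_mono_of_nonneg (Eventually.of_forall fun ω => by
          dsimp only
          split_ifs
          · exact sq_nonneg _
          · exact le_rfl) (hint.div_const _) (Eventually.of_forall fun ω => sq_tail_le hT hν)
    _ = (∫ ω, |X ω| ^ (2 + 2 * ν) ∂μ) / T ^ ν := integral_div _ _
    _ ≤ max M 0 / T ^ ν := by gcongr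
    _ ≤ e := by
        rw [div_le_iff₀ hTν, mul_comm]
        exact (div_le_iff₀ he).1 hTM

/-- The second moment of an innovation is the probability of a nonzero return. -/
theorem integral_sq_eq_of_cond {n t : ℕ} {p : ℝ} (hp : 0 < p)
    (hv : 0 < v ((t : ℝ) / n))
    (hprob : μ.real {ω | aproc v ε n t ω * aproc v ε n (t - 0) ω = 1} = p)
    (hid : ∫ ω, (ε n t ω) ^ 2 ∂(μ[|{ω | aproc v ε n t ω = 1}]) = 1) :
    ∫ ω, ε n t ω ^ 2 ∂μ = p := by
  have hset : {ω | aproc v ε n t ω * aproc v ε n (t - 0) ω = 1} = {ω | aproc v ε n t ω = 1} := by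
    ext ω
    simp only [Nat.sub_zero, mem_ofPred_eq, aproc]
    split_ifs <;> simp
  have hsupp : ∀ ω, ω ∉ {ω | aproc v ε n t ω = 1} → ε n t ω ^ 2 = 0 := by
    intro ω hω
    by_contra hne
    refine hω ?_
    have : rproc v ε n t ω ≠ 0 := mul_ne_zero hv.ne' fun h0 => hne (by rw [h0]; norm_num)
    simp [aproc, this]
  rw [hset] at hprob
  rw [ProbabilityTheory.cond, integral_smul_measure,
    setIntegral_eq_integral_of_forall_compl_eq_zero hsupp, ENNReal.toReal_inv, smul_eq_mul] at hid
  change (μ.real {ω | aproc v ε n t ω = 1})⁻¹ * _ = 1 at hid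
  rw [hprob] at hid
  field_simp at hid
  exact hid

theorem integrable_sq_mul {X D : Ω → ℝ} (hint : Integrable (fun ω => X ω ^ 2) μ)
    (hD : Measurable D) {C : ℝ} (hC : ∀ ω, |D ω| ≤ C) :
    Integrable (fun ω => X ω ^ 2 * D ω) μ :=
  hint.mul_bdd hD.aestronglyMeasurable (Eventually.of_forall hC)

theorem measurable_phat2 (hε : ∀ n t, Measurable (ε n t)) (K : ℝ → ℝ) (b : ℕ → ℝ) (n h t : ℕ) :
    Measurable (phat2 v ε K b n h t) :=
  Finset.measurable_fun_sum _ fun j _ =>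
    ((measurable_aproc v ε (hε n j)).mul (measurable_aproc v ε (hε n (j - h)))).const_mul _

theorem measurable_phatRatio (hε : ∀ n t, Measurable (ε n t)) (K : ℝ → ℝ) (b : ℕ → ℝ)
    (n h t : ℕ) : Measurable (phatRatio v ε K b n h t) := by
  have hphat : Measurable (phat v ε K b n t) := by
    have : phat v ε K b n t = phat2 v ε K b n 0 t := funext (phat_eq_phat2 v ε K b n t)
    rw [this]
    exact measurable_phat2 hε K b n 0 t
  exact Measurable.ite (measurableSet_eq_fun hphat measurable_const) measurable_const
    ((measurable_phat2 hε K b n h t).div hphat)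

variable {K : ℝ → ℝ} {b : ℕ → ℝ}

theorem integrable_average_rproc_sq_mul (hint : ∀ n t, 1 ≤ t → t ≤ n →
      Integrable (fun ω => ε n t ω ^ 2) μ) (hε : ∀ n t, Measurable (ε n t))
    (hK : ∀ z, 0 ≤ K z) (n h : ℕ) :
    Integrable (fun ω => (n : ℝ)⁻¹ * ∑ t ∈ Finset.Icc (h + 1) n,
      rproc v ε n t ω ^ 2 * phatRatio v ε K b n h t ω) μ := by
  refine (integrable_finsetSum _ fun t ht => ?_).const_mul _
  rw [Finset.mem_Icc] at ht
  refine integrable_sq_mul ?_ (measurable_phatRatio hε K b n h t) (C := 1) fun ω => ?_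
  · simp only [rproc, mul_pow]
    exact (hint n t (by omega) ht.2).const_mul _
  · rw [abs_of_nonneg (phatRatio_nonneg hK n h t ω)]
    exact phatRatio_le_one hK n h t ω

variable [IsProbabilityMeasure μ]

theorem integrable_phat2 (hε : ∀ n t, Measurable (ε n t)) (hK : ∀ z, 0 ≤ K z) (n h t : ℕ) :
    Integrable (phat2 v ε K b n h t) μ :=
  Integrable.of_bound (measurable_phat2 hε K b n h t).aestronglyMeasurable 1
    (Eventually.of_forall fun ω => by
      rw [Real.norm_eq_abs, abs_of_nonneg (phat2_nonneg hK n h t ω)]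
      exact phat2_le_one hK n h t ω)

/-- Pointwise `L¹` consistency of the kernel estimator of `P(a_t a_{t-h} = 1)`. -/
theorem tendsto_integral_abs_phat2_sub {f : ℝ → ℝ} {h : ℕ} {R : ℝ}
    (hα : Summable (alphaMix μ ε)) (hε : ∀ n t, Measurable (ε n t))
    (hprob : ∀ n t : ℕ, h < t → t ≤ n →
      μ.real {ω | aproc v ε n t ω * aproc v ε n (t - h) ω = 1} = f ((t : ℝ) / n))
    (hK_supp : HasCompactSupport K) (hK_nonneg : ∀ z, 0 ≤ K z) (hK_le : ∀ z, K z ≤ R)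
    (hb_pos : ∀ n, 0 < b n) (hb0 : Tendsto b atTop (nhds 0)) {s : ℝ} (hs : 0 < s)
    (hS : Tendsto (fun n : ℕ => ∑ i ∈ Finset.Icc 1 n, Kw K b n ⌈(n : ℝ) * s⌉₊ i) atTop atTop)
    (hf : ContinuousAt f s) :
    Tendsto (fun n : ℕ => ∫ ω, |phat2 v ε K b n h ⌈(n : ℝ) * s⌉₊ ω - f s| ∂μ) atTop
      (nhds 0) := by
  obtain ⟨β, hβ, hβ0, hcov⟩ := exists_summable_cov_bound μ ε hα h
  have hbias := tendsto_sum_wgt_mul hK_supp hK_nonneg hb_pos hb0 hs hS hf h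
  have hvar : Tendsto (fun n : ℕ => √(2 * (R / ∑ i ∈ Finset.Icc 1 n, Kw K b n ⌈(n : ℝ) * s⌉₊ i)
      * 1 * ∑' k, β k)) atTop (nhds 0) := by
    have h1 := hS.const_div_atTop R
    have h2 := (((h1.const_mul 2).mul_const 1).mul_const (∑' k, β k)).sqrt
    simpa using h2
  have htot := hvar.add (hbias.sub_const (f s)).abs
  rw [sub_self, abs_zero, add_zero] at htot
  refine squeeze_zero' (Eventually.of_forall fun n => integral_nonneg fun ω => abs_nonneg _) ?_ htot
  filter_upwards [hS.eventually_gt_atTop 0] with n hpos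
  set t := ⌈(n : ℝ) * s⌉₊
  set S := ∑ i ∈ Finset.Icc 1 n, Kw K b n t i
  set B : ℕ → Set Ω := fun j => {ω | aproc v ε n j ω * aproc v ε n (j - h) ω = 1} with hB
  have hR : 0 ≤ R := (hK_nonneg 0).trans (hK_le 0)
  have hKw : ∀ j, Kw K b n t j ≤ R := by
    intro j
    unfold Kw
    split_ifs
    · exact hR
    · exact hK_le _
  have hwle : ∀ j, |wgt K b n t j| ≤ R / S := by
    intro j
    rw [abs_of_nonneg (wgt_nonneg hK_nonneg n t j)]
    exact div_le_div_of_nonneg_right (hKw j) hpos.le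
  have hwsum : ∑ j ∈ Finset.Icc (h + 1) n, |wgt K b n t j| ≤ 1 := by
    simp only [fun j => abs_of_nonneg (wgt_nonneg (b := b) hK_nonneg n t j)]
    exact sum_wgt_le_one n h t hK_nonneg
  have hBm : ∀ j, MeasurableSet (B j) := fun j =>
    measurableSet_aproc_mul v ε (hε n j) (hε n (j - h))
  have hmain := integral_abs_weighted_indicator_le μ (Finset.Icc (h + 1) n)
    (fun j _ => hBm j) hβ hβ0 (fun i _ j _ hij => abs_cov_aproc_mul_le hcov hij)
    (fun j _ => hwle j) hwsum (by positivity)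
  have hdec : ∀ ω, phat2 v ε K b n h t ω - f s
      = ∑ j ∈ Finset.Icc (h + 1) n, wgt K b n t j *
          ((B j).indicator (fun _ => (1 : ℝ)) ω - μ.real (B j))
        + (∑ j ∈ Finset.Icc (h + 1) n, wgt K b n t j * f ((j : ℝ) / n) - f s) := by
    intro ω
    rw [← add_sub_assoc, ← Finset.sum_add_distrib]
    congr 1
    refine Finset.sum_congr rfl fun j hj => ?_
    rw [Finset.mem_Icc] at hj
    rw [aproc_mul_eq_indicator, hB, ← hprob n j (by omega) hj.2]
    ring
  have hint : Integrable (fun ω => |∑ j ∈ Finset.Icc (h + 1) n, wgt K b n t j *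
      ((B j).indicator (fun _ => (1 : ℝ)) ω - μ.real (B j))|) μ :=
    (integrable_finsetSum _ fun j _ => ((((integrable_const (1 : ℝ)).indicator (hBm j)).sub
      (integrable_const _)).const_mul _)).abs
  calc ∫ ω, |phat2 v ε K b n h t ω - f s| ∂μ
      ≤ ∫ ω, (|∑ j ∈ Finset.Icc (h + 1) n, wgt K b n t j *
          ((B j).indicator (fun _ => (1 : ℝ)) ω - μ.real (B j))|
        + |∑ j ∈ Finset.Icc (h + 1) n, wgt K b n t j * f ((j : ℝ) / n) - f s|) ∂μ := by
        refine integral_mono ((integrable_phat2 hε hK_nonneg n h t).sub (integrable_const _)).abs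
          (hint.add (integrable_const _)) fun ω => ?_
        dsimp only
        rw [hdec ω]
        exact abs_add_le _ _
    _ = ∫ ω, |∑ j ∈ Finset.Icc (h + 1) n, wgt K b n t j *
          ((B j).indicator (fun _ => (1 : ℝ)) ω - μ.real (B j))| ∂μ
        + |∑ j ∈ Finset.Icc (h + 1) n, wgt K b n t j * f ((j : ℝ) / n) - f s| := by
        rw [integral_add hint (integrable_const _)]
        simp
    _ ≤ _ := by gcongr

/-- Riemann sums of an almost everywhere continuous bounded function, dropping `h` terms. -/
theorem tendsto_average_Icc {f : ℝ → ℝ} {C : ℝ} (h : ℕ)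
    (hf : ∀ s ∈ Ioc (0 : ℝ) 1, |f s| ≤ C)
    (hcont : ∀ᵐ s ∂(volume.restrict (Ioc (0 : ℝ) 1)), ContinuousAt f s) :
    Tendsto (fun n : ℕ => (n : ℝ)⁻¹ * ∑ t ∈ Finset.Icc (h + 1) n, f ((t : ℝ) / n)) atTop
      (nhds (∫ s in Ioc (0 : ℝ) 1, f s)) := by
  have hC : 0 ≤ C := (abs_nonneg _).trans (hf 1 (by norm_num))
  have hlim := tendsto_average_of_ae_tendsto_ceil (f := f) (C := C)
    (F := fun n t => if h < t then f ((t : ℝ) / n) else 0) (by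
      intro n t ht htn
      split_ifs
      · have ht' : (0 : ℝ) < t := by exact_mod_cast ht
        have htn' : (t : ℝ) ≤ n := by exact_mod_cast htn
        exact hf _ ⟨div_pos ht' (ht'.trans_le htn'), div_le_one_of_le₀ htn' (by positivity)⟩
      · simpa using hC) (by
      filter_upwards [hcont, ae_restrict_mem measurableSet_Ioc] with s hs hmem
      refine (hs.tendsto.comp (tendsto_ceil_mul_div hmem.1.le)).congr' ?_
      filter_upwards [(tendsto_natCast_atTop_atTop (R := ℝ)).eventually_gt_atTop ((h : ℝ) / s)]
        with n hn
      rw [if_pos, Function.comp_apply]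
      rw [Nat.lt_ceil]
      exact (div_lt_iff₀ hmem.1).1 hn)
  refine hlim.congr fun n => ?_
  congr 1
  rw [← Finset.sum_filter]
  refine Finset.sum_congr ?_ fun _ _ => rfl
  ext t
  simp only [Finset.mem_filter, Finset.mem_Icc]
  omega

theorem tendsto_sqrt_div_nat (a : ℝ) : Tendsto (fun n : ℕ => √(a / n)) atTop (nhds 0) := by
  simpa using (tendsto_const_div_atTop_nhds_zero_nat a).sqrt

/-- Weighted averages of row-wise weakly dependent events obey the `L¹` law of large numbers. -/
theorem tendsto_integral_abs_average_indicator {B : ℕ → ℕ → Set Ω} {β : ℕ → ℝ} {h : ℕ}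
    (hBm : ∀ n t, MeasurableSet (B n t)) (hβ : Summable β) (hβ0 : ∀ k, 0 ≤ β k)
    (hcov : ∀ n i j : ℕ, i ≤ j →
      |μ.real (B n i ∩ B n j) - μ.real (B n i) * μ.real (B n j)| ≤ β (j - i))
    {c : ℕ → ℕ → ℝ} {C : ℝ} (hC : 0 ≤ C) (hc : ∀ n t, 1 ≤ t → t ≤ n → |c n t| ≤ C) :
    Tendsto (fun n : ℕ => ∫ ω, |(n : ℝ)⁻¹ * ∑ t ∈ Finset.Icc (h + 1) n,
      c n t * ((B n t).indicator (fun _ => (1 : ℝ)) ω - μ.real (B n t))| ∂μ) atTop (nhds 0) := by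
  refine squeeze_zero (fun n => integral_nonneg fun ω => abs_nonneg _) (fun n => ?_)
    (tendsto_sqrt_div_nat (2 * C * C * ∑' k, β k))
  have hcn : ∀ j ∈ Finset.Icc (h + 1) n, |(n : ℝ)⁻¹ * c n j| ≤ C / n := by
    intro j hj
    rw [Finset.mem_Icc] at hj
    rw [abs_mul, abs_of_nonneg (by positivity), inv_mul_eq_div]
    have := hc n j (by omega) hj.2
    gcongr
  have hsum : ∑ j ∈ Finset.Icc (h + 1) n, |(n : ℝ)⁻¹ * c n j| ≤ C := by
    refine (Finset.sum_le_card_nsmul _ _ _ hcn).trans ?_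
    rw [Nat.card_Icc, nsmul_eq_mul]
    rcases Nat.eq_zero_or_pos n with hn | hn
    · simp [hn, hC]
    · have hn' : (0 : ℝ) < n := by exact_mod_cast hn
      have : ((n + 1 - (h + 1) : ℕ) : ℝ) ≤ n := by
        have : n + 1 - (h + 1) ≤ n := by omega
        exact_mod_cast this
      calc ((n + 1 - (h + 1) : ℕ) : ℝ) * (C / n) ≤ n * (C / n) := by gcongr
        _ = C := by field_simp
  have hmain := integral_abs_weighted_indicator_le μ (Finset.Icc (h + 1) n)
    (fun j _ => hBm n j) hβ hβ0 (fun i _ j _ hij => hcov n i j hij) hcn hsum (by positivity)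
  calc _ = ∫ ω, |∑ j ∈ Finset.Icc (h + 1) n, (n : ℝ)⁻¹ * c n j *
          ((B n j).indicator (fun _ => (1 : ℝ)) ω - μ.real (B n j))| ∂μ := by
        simp only [Finset.mul_sum, mul_assoc]
    _ ≤ √(2 * (C / n) * C * ∑' k, β k) := hmain
    _ = √(2 * C * C * (∑' k, β k) / n) := by ring_nf

/-- `L¹` law of large numbers for `a_t a_{t-h}`. -/
theorem tendsto_integral_abs_average_aproc {f : ℝ → ℝ} {h : ℕ}
    (hα : Summable (alphaMix μ ε)) (hε : ∀ n t, Measurable (ε n t))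
    (hprob : ∀ n t : ℕ, h < t → t ≤ n →
      μ.real {ω | aproc v ε n t ω * aproc v ε n (t - h) ω = 1} = f ((t : ℝ) / n))
    {C : ℝ} (hf : ∀ s ∈ Ioc (0 : ℝ) 1, |f s| ≤ C)
    (hcont : ∀ᵐ s ∂(volume.restrict (Ioc (0 : ℝ) 1)), ContinuousAt f s) :
    Tendsto (fun n : ℕ => ∫ ω, |(n : ℝ)⁻¹ * ∑ t ∈ Finset.Icc (h + 1) n,
      aproc v ε n t ω * aproc v ε n (t - h) ω - ∫ s in Ioc (0 : ℝ) 1, f s| ∂μ) atTop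
      (nhds 0) := by
  obtain ⟨β, hβ, hβ0, hcov⟩ := exists_summable_cov_bound μ ε hα h
  set B : ℕ → ℕ → Set Ω := fun n j => {ω | aproc v ε n j ω * aproc v ε n (j - h) ω = 1} with hB
  have hBm : ∀ n j, MeasurableSet (B n j) := fun n j =>
    measurableSet_aproc_mul v ε (hε n j) (hε n (j - h))
  have h1 := tendsto_integral_abs_average_indicator (μ := μ) (B := B) (h := h) hBm hβ hβ0
    (fun n i j hij => abs_cov_aproc_mul_le hcov hij) (c := fun _ _ => 1) zero_le_one (by simp)
  have h2 := ((tendsto_average_Icc h hf hcont).sub_const (∫ s in Ioc (0 : ℝ) 1, f s)).abs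
  have htot := h1.add h2
  rw [sub_self, abs_zero, add_zero] at htot
  refine squeeze_zero (fun n => integral_nonneg fun ω => abs_nonneg _) (fun n => ?_) htot
  have hint : Integrable (fun ω => |(n : ℝ)⁻¹ * ∑ t ∈ Finset.Icc (h + 1) n,
      1 * ((B n t).indicator (fun _ => (1 : ℝ)) ω - μ.real (B n t))|) μ :=
    ((integrable_finsetSum _ fun j _ => ((((integrable_const (1 : ℝ)).indicator (hBm n j)).sub
      (integrable_const _)).const_mul _)).const_mul _).abs
  have hle : ∀ ω, |(n : ℝ)⁻¹ * ∑ t ∈ Finset.Icc (h + 1) n,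
        aproc v ε n t ω * aproc v ε n (t - h) ω - ∫ s in Ioc (0 : ℝ) 1, f s|
      ≤ |(n : ℝ)⁻¹ * ∑ t ∈ Finset.Icc (h + 1) n,
          1 * ((B n t).indicator (fun _ => (1 : ℝ)) ω - μ.real (B n t))|
        + |(n : ℝ)⁻¹ * ∑ t ∈ Finset.Icc (h + 1) n, f ((t : ℝ) / n)
          - ∫ s in Ioc (0 : ℝ) 1, f s| := by
    intro ω
    refine le_of_eq_of_le ?_ (abs_add_le _ _)
    rw [← add_sub_assoc, ← mul_add, ← Finset.sum_add_distrib]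
    congr 3
    refine Finset.sum_congr rfl fun j hj => ?_
    rw [Finset.mem_Icc] at hj
    rw [aproc_mul_eq_indicator, hB, ← hprob n j (by omega) hj.2]
    ring
  refine (integral_mono_of_nonneg (Eventually.of_forall fun _ => abs_nonneg _)
    (hint.add (integrable_const _)) (Eventually.of_forall hle)).trans (le_of_eq ?_)
  simp only [Pi.add_apply]
  rw [integral_add hint (integrable_const _)]
  simp

theorem integrable_sq_of_rpow {X : Ω → ℝ} (hX : Measurable X) {p : ℝ} (hp : 2 ≤ p)
    (hint : Integrable (fun ω => |X ω| ^ p) μ) : Integrable (fun ω => X ω ^ 2) μ := by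
  refine ((integrable_const (1 : ℝ)).add hint).mono' (hX.pow_const 2).aestronglyMeasurable
    (Eventually.of_forall fun ω => ?_)
  have hnn : 0 ≤ |X ω| ^ p := Real.rpow_nonneg (abs_nonneg _) _
  rw [Real.norm_eq_abs, abs_of_nonneg (sq_nonneg _), Pi.add_apply, ← sq_abs]
  rcases le_total |X ω| 1 with h1 | h1
  · nlinarith [abs_nonneg (X ω)]
  · have := Real.rpow_le_rpow_of_exponent_le h1 hp
    rw [Real.rpow_two] at this
    linarith

/-- Approximation of a nonnegative number by a multiple of `δ` capped at `N δ`. -/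
theorem abs_sub_step_le {x δ T : ℝ} (hx : 0 ≤ x) (hδ : 0 < δ) {N : ℕ} (hT : T ≤ N * δ) :
    |x - δ * ∑ i ∈ Finset.Icc 1 N, (if (i : ℝ) * δ ≤ x then (1 : ℝ) else 0)|
      ≤ δ + if T ≤ x then x else 0 := by
  have hcount : ∑ i ∈ Finset.Icc 1 N, (if (i : ℝ) * δ ≤ x then (1 : ℝ) else 0)
      = (min N ⌊x / δ⌋₊ : ℕ) := by
    rw [Finset.sum_boole]
    congr 1
    have : (Finset.Icc 1 N).filter (fun i : ℕ => (i : ℝ) * δ ≤ x)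
        = Finset.Icc 1 (min N ⌊x / δ⌋₊) := by
      ext i
      have hiff : (i : ℝ) * δ ≤ x ↔ i ≤ ⌊x / δ⌋₊ := by
        rw [Nat.le_floor_iff (by positivity), le_div_iff₀ hδ]
      simp only [Finset.mem_filter, Finset.mem_Icc, hiff, le_min_iff]
      tauto
    rw [this, Nat.card_Icc]
    omega
  rw [hcount]
  have hfl : (⌊x / δ⌋₊ : ℝ) * δ ≤ x := by
    have := Nat.floor_le (a := x / δ) (by positivity)
    rwa [le_div_iff₀ hδ] at this
  have hfu : x < (⌊x / δ⌋₊ + 1) * δ := by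
    have := Nat.lt_floor_add_one (x / δ)
    rwa [div_lt_iff₀ hδ] at this
  rcases le_total N ⌊x / δ⌋₊ with hN | hN
  · rw [min_eq_left hN]
    have hN' : (N : ℝ) ≤ ⌊x / δ⌋₊ := by exact_mod_cast hN
    have hNx : N * δ ≤ x := (mul_le_mul_of_nonneg_right hN' hδ.le).trans hfl
    have hN0 : 0 ≤ δ * N := by positivity
    rw [if_pos (hT.trans hNx), abs_of_nonneg (by linarith)]
    linarith
  · rw [min_eq_right hN, abs_of_nonneg (by linarith)]
    have : 0 ≤ if T ≤ x then x else 0 := by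
      split_ifs
      · exact hx
      · exact le_rfl
    linarith

theorem abs_average_le {a : ℕ → ℝ} {C : ℝ} (hC : 0 ≤ C) {n h : ℕ}
    (ha : ∀ t, 1 ≤ t → t ≤ n → a t ≤ C) : (n : ℝ)⁻¹ * ∑ t ∈ Finset.Icc (h + 1) n, a t ≤ C := by
  have h1 : ∑ t ∈ Finset.Icc (h + 1) n, a t ≤ n * C := by
    refine (Finset.sum_le_card_nsmul _ _ C fun t ht => ?_).trans ?_
    · rw [Finset.mem_Icc] at ht
      exact ha t (by omega) ht.2
    · rw [nsmul_eq_mul, Nat.card_Icc]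
      gcongr
      omega
  rcases Nat.eq_zero_or_pos n with hn | hn
  · simp [hn, hC]
  · have hn' : (0 : ℝ) < n := by exact_mod_cast hn
    rw [inv_mul_eq_div, div_le_iff₀ hn']
    linarith

/-- `L¹` law of large numbers for weighted averages of the squared innovations. -/
theorem tendsto_integral_abs_average_sq (hα : Summable (alphaMix μ ε))
    (hε : ∀ n t, Measurable (ε n t))
    (hint : ∀ n t, 1 ≤ t → t ≤ n → Integrable (fun ω => ε n t ω ^ 2) μ)
    (hUI : ∀ e > 0, ∃ T : ℝ, 0 < T ∧ ∀ n t, 1 ≤ t → t ≤ n →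
      ∫ ω, (if T ≤ ε n t ω ^ 2 then ε n t ω ^ 2 else 0) ∂μ ≤ e)
    {c : ℕ → ℕ → ℝ} {C : ℝ} (hC : 0 ≤ C) (hc : ∀ n t, 1 ≤ t → t ≤ n → |c n t| ≤ C) (h : ℕ) :
    Tendsto (fun n : ℕ => ∫ ω, |(n : ℝ)⁻¹ * ∑ t ∈ Finset.Icc (h + 1) n,
      c n t * (ε n t ω ^ 2 - ∫ ω, ε n t ω ^ 2 ∂μ)| ∂μ) atTop (nhds 0) := by
  obtain ⟨β, hβ, hβ0, hcov⟩ := exists_summable_cov_bound μ ε hα 0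
  rw [Metric.tendsto_nhds]
  intro e he
  set δ := e / (8 * (C + 1)) with hδ
  have hδ0 : 0 < δ := by positivity
  obtain ⟨T, hT, hTe⟩ := hUI δ hδ0
  set N := ⌈T / δ⌉₊ with hN
  have hTN : T ≤ N * δ := (div_le_iff₀ hδ0).1 (Nat.le_ceil _)
  set B : ℕ → ℕ → ℕ → Set Ω := fun i n t => {ω | (i : ℝ) * δ ≤ ε n t ω ^ 2} with hB
  have hBm : ∀ i n t, MeasurableSet (B i n t) := fun i n t =>
    measurableSet_le measurable_const ((hε n t).pow_const 2)
  have hlim : Tendsto (fun n : ℕ => δ * ∑ i ∈ Finset.Icc 1 N,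
      ∫ ω, |(n : ℝ)⁻¹ * ∑ t ∈ Finset.Icc (h + 1) n,
        c n t * ((B i n t).indicator (fun _ => (1 : ℝ)) ω - μ.real (B i n t))| ∂μ) atTop
      (nhds 0) := by
    have := (tendsto_finsetSum (Finset.Icc 1 N) fun i _ =>
      tendsto_integral_abs_average_indicator (μ := μ) (B := B i) (h := h) (hBm i) hβ hβ0
        (fun n j k hjk => hcov n j k _ _ hjk
          (measurableSet_le measurable_const
            ((measurable_of_le_pastField ε le_rfl).pow_const 2))
          (measurableSet_le measurable_const
            ((measurable_of_futureField_le ε (Nat.sub_le k 0)).pow_const 2))) hC hc).const_mul δ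
    simpa using this
  filter_upwards [hlim.eventually (gt_mem_nhds (half_pos he))] with n hn
  rw [Real.dist_eq, sub_zero, abs_of_nonneg (integral_nonneg fun ω => abs_nonneg _)]
  set D : ℕ → Ω → ℝ := fun t ω =>
    ε n t ω ^ 2 - δ * ∑ i ∈ Finset.Icc 1 N, (B i n t).indicator (fun _ => (1 : ℝ)) ω with hD
  have hindint : ∀ i t, Integrable ((B i n t).indicator (fun _ => (1 : ℝ))) μ := fun i t =>
    (integrable_const (1 : ℝ)).indicator (hBm i n t)
  have hstepint : ∀ t, Integrable (fun ω => δ * ∑ i ∈ Finset.Icc 1 N,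
      (B i n t).indicator (fun _ => (1 : ℝ)) ω) μ := fun t =>
    (integrable_finsetSum _ fun i _ => hindint i t).const_mul _
  have hDint : ∀ t, 1 ≤ t → t ≤ n → Integrable (D t) μ := fun t h1 h2 =>
    (hint n t h1 h2).sub (hstepint t)
  have hDle : ∀ t ω, |D t ω| ≤ δ + if T ≤ ε n t ω ^ 2 then ε n t ω ^ 2 else 0 := fun t ω =>
    abs_sub_step_le (sq_nonneg _) hδ0 hTN
  have hDE : ∀ t, 1 ≤ t → t ≤ n → ∫ ω, |D t ω| ∂μ ≤ 2 * δ := by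
    intro t h1 h2
    have htail := integrable_sq_tail (hε n t) (hint n t h1 h2) T
    calc ∫ ω, |D t ω| ∂μ ≤ ∫ ω, (δ + if T ≤ ε n t ω ^ 2 then ε n t ω ^ 2 else 0) ∂μ :=
          integral_mono (hDint t h1 h2).abs ((integrable_const δ).add htail) (hDle t)
      _ = δ + ∫ ω, (if T ≤ ε n t ω ^ 2 then ε n t ω ^ 2 else 0) ∂μ := by
          rw [integral_add (integrable_const δ) htail]
          simp
      _ ≤ 2 * δ := by linarith [hTe n t h1 h2]
  have hDexp : ∀ t, 1 ≤ t → t ≤ n → ∫ ω, D t ω ∂μ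
      = ∫ ω, ε n t ω ^ 2 ∂μ - δ * ∑ i ∈ Finset.Icc 1 N, μ.real (B i n t) := by
    intro t h1 h2
    rw [integral_sub (hint n t h1 h2) (hstepint t), integral_const_mul,
      integral_finsetSum _ fun i _ => hindint i t]
    simp only [integral_indicator_const _ (hBm _ n t), smul_eq_mul, mul_one]
  set Y : ℕ → Ω → ℝ := fun i ω => (n : ℝ)⁻¹ * ∑ t ∈ Finset.Icc (h + 1) n,
    c n t * ((B i n t).indicator (fun _ => (1 : ℝ)) ω - μ.real (B i n t)) with hY
  have hYint : ∀ i, Integrable (Y i) μ := fun i =>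
    (integrable_finsetSum _ fun t _ =>
      (((hindint i t).sub (integrable_const _)).const_mul _)).const_mul _
  have hpt : ∀ ω, |(n : ℝ)⁻¹ * ∑ t ∈ Finset.Icc (h + 1) n,
        c n t * (ε n t ω ^ 2 - ∫ ω, ε n t ω ^ 2 ∂μ)|
      ≤ δ * ∑ i ∈ Finset.Icc 1 N, |Y i ω|
        + (n : ℝ)⁻¹ * ∑ t ∈ Finset.Icc (h + 1) n, C * (|D t ω| + 2 * δ) := by
    intro ω
    have hsplit : (n : ℝ)⁻¹ * ∑ t ∈ Finset.Icc (h + 1) n,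
          c n t * (ε n t ω ^ 2 - ∫ ω, ε n t ω ^ 2 ∂μ)
        = δ * ∑ i ∈ Finset.Icc 1 N, Y i ω
          + (n : ℝ)⁻¹ * ∑ t ∈ Finset.Icc (h + 1) n, c n t * (D t ω - ∫ ω, D t ω ∂μ) := by
      rw [hY, ← Finset.mul_sum, Finset.sum_comm, mul_left_comm, ← mul_add]
      congr 1
      rw [Finset.mul_sum, ← Finset.sum_add_distrib]
      refine Finset.sum_congr rfl fun t ht => ?_
      rw [Finset.mem_Icc] at ht
      rw [hDexp t (by omega) ht.2, ← Finset.mul_sum, Finset.sum_sub_distrib]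
      simp only [hD]
      ring
    rw [hsplit]
    refine (abs_add_le _ _).trans (add_le_add ?_ ?_)
    · rw [abs_mul, abs_of_pos hδ0]
      gcongr
      exact Finset.abs_sum_le_sum_abs _ _
    · rw [abs_mul, abs_of_nonneg (by positivity)]
      gcongr
      refine (Finset.abs_sum_le_sum_abs _ _).trans (Finset.sum_le_sum fun t ht => ?_)
      rw [Finset.mem_Icc] at ht
      rw [abs_mul]
      have h1 := hc n t (by omega) ht.2
      have h2 : |D t ω - ∫ ω, D t ω ∂μ| ≤ |D t ω| + 2 * δ := by
        refine (abs_sub _ _).trans ?_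
        gcongr
        exact abs_integral_le_integral_abs.trans (hDE t (by omega) ht.2)
      gcongr
  have hint1 : Integrable (fun ω => δ * ∑ i ∈ Finset.Icc 1 N, |Y i ω|) μ :=
    (integrable_finsetSum _ fun i _ => (hYint i).abs).const_mul _
  have hDt : ∀ t ∈ Finset.Icc (h + 1) n, Integrable (fun ω => C * (|D t ω| + 2 * δ)) μ := by
    intro t ht
    rw [Finset.mem_Icc] at ht
    exact ((hDint t (by omega) ht.2).abs.add (integrable_const _)).const_mul _
  have hint2 : Integrable (fun ω => (n : ℝ)⁻¹ *
      ∑ t ∈ Finset.Icc (h + 1) n, C * (|D t ω| + 2 * δ)) μ :=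
    (integrable_finsetSum _ hDt).const_mul _
  have hrest : ∫ ω, (n : ℝ)⁻¹ * ∑ t ∈ Finset.Icc (h + 1) n, C * (|D t ω| + 2 * δ) ∂μ
      ≤ C * (4 * δ) := by
    rw [integral_const_mul, integral_finsetSum _ hDt]
    refine abs_average_le (by positivity) fun t h1 h2 => ?_
    rw [integral_const_mul, integral_add (hDint t h1 h2).abs (integrable_const _)]
    have := hDE t h1 h2
    gcongr
    simp
    linarith
  have hδC : C * (4 * δ) < e / 2 := by
    have : e = δ * (8 * (C + 1)) := by rw [hδ]; field_simp
    nlinarith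
  calc ∫ ω, |(n : ℝ)⁻¹ * ∑ t ∈ Finset.Icc (h + 1) n,
        c n t * (ε n t ω ^ 2 - ∫ ω, ε n t ω ^ 2 ∂μ)| ∂μ
      ≤ ∫ ω, (δ * ∑ i ∈ Finset.Icc 1 N, |Y i ω|
        + (n : ℝ)⁻¹ * ∑ t ∈ Finset.Icc (h + 1) n, C * (|D t ω| + 2 * δ)) ∂μ :=
        integral_mono_of_nonneg (Eventually.of_forall fun _ => abs_nonneg _) (hint1.add hint2)
          (Eventually.of_forall hpt)
    _ = δ * ∑ i ∈ Finset.Icc 1 N, ∫ ω, |Y i ω| ∂μ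
        + ∫ ω, (n : ℝ)⁻¹ * ∑ t ∈ Finset.Icc (h + 1) n, C * (|D t ω| + 2 * δ) ∂μ := by
        rw [integral_add hint1 hint2, integral_const_mul,
          integral_finsetSum _ fun i _ => (hYint i).abs]
    _ < e / 2 + e / 2 := by
        refine add_lt_add hn (hrest.trans_lt hδC)
    _ = e := add_halves e

/-- Pointwise `L¹` consistency of the estimator `p̂_{t,t-h} / p̂_t`. -/
theorem tendsto_integral_abs_phatRatio_sub {f₀ f : ℝ → ℝ} {h : ℕ} {R : ℝ}
    (hα : Summable (alphaMix μ ε)) (hε : ∀ n t, Measurable (ε n t))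
    (hprob₀ : ∀ n t : ℕ, 0 < t → t ≤ n →
      μ.real {ω | aproc v ε n t ω * aproc v ε n (t - 0) ω = 1} = f₀ ((t : ℝ) / n))
    (hprob : ∀ n t : ℕ, h < t → t ≤ n →
      μ.real {ω | aproc v ε n t ω * aproc v ε n (t - h) ω = 1} = f ((t : ℝ) / n))
    (hK_supp : HasCompactSupport K) (hK_nonneg : ∀ z, 0 ≤ K z) (hK_le : ∀ z, K z ≤ R)
    (hb_pos : ∀ n, 0 < b n) (hb0 : Tendsto b atTop (nhds 0)) {s : ℝ} (hs : 0 < s)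
    (hS : Tendsto (fun n : ℕ => ∑ i ∈ Finset.Icc 1 n, Kw K b n ⌈(n : ℝ) * s⌉₊ i) atTop atTop)
    (hf₀ : ContinuousAt f₀ s) (hf : ContinuousAt f s) (hpos : 0 < f₀ s) :
    Tendsto (fun n : ℕ => ∫ ω, |phatRatio v ε K b n h ⌈(n : ℝ) * s⌉₊ ω
      - f ((⌈(n : ℝ) * s⌉₊ : ℝ) / n) / f₀ ((⌈(n : ℝ) * s⌉₊ : ℝ) / n)| ∂μ) atTop (nhds 0) := by
  have h0 := tendsto_integral_abs_phat2_sub hα hε hprob₀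
    hK_supp hK_nonneg hK_le hb_pos hb0 hs hS hf₀
  have h1 := tendsto_integral_abs_phat2_sub hα hε hprob
    hK_supp hK_nonneg hK_le hb_pos hb0 hs hS hf
  have hq : Tendsto (fun n : ℕ => |f s / f₀ s
      - f ((⌈(n : ℝ) * s⌉₊ : ℝ) / n) / f₀ ((⌈(n : ℝ) * s⌉₊ : ℝ) / n)|) atTop (nhds 0) := by
    have := (((hf.div hf₀ hpos.ne').tendsto.comp (tendsto_ceil_mul_div hs.le)).const_sub
      (f s / f₀ s)).abs
    simpa using this
  have hlim := ((h0.add h1).const_mul (f₀ s)⁻¹).add hq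
  simp only [add_zero, mul_zero] at hlim
  refine squeeze_zero (fun n => integral_nonneg fun ω => abs_nonneg _) (fun n => ?_) hlim
  generalize ⌈(n : ℝ) * s⌉₊ = t
  have i0 : Integrable (fun ω => |phat2 v ε K b n 0 t ω - f₀ s|) μ :=
    ((integrable_phat2 hε hK_nonneg n 0 t).sub (integrable_const _)).abs
  have i1 : Integrable (fun ω => |phat2 v ε K b n h t ω - f s|) μ :=
    ((integrable_phat2 hε hK_nonneg n h t).sub (integrable_const _)).abs
  have i2 : Integrable (fun ω => (f₀ s)⁻¹ *
      (|phat2 v ε K b n 0 t ω - f₀ s| + |phat2 v ε K b n h t ω - f s|)) μ :=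
    (i0.add i1).const_mul _
  rw [← integral_add i0 i1, ← integral_const_mul]
  set z := f ((t : ℝ) / n) / f₀ ((t : ℝ) / n)
  calc ∫ ω, |phatRatio v ε K b n h t ω - z| ∂μ
      ≤ ∫ ω, ((f₀ s)⁻¹ * (|phat2 v ε K b n 0 t ω - f₀ s| + |phat2 v ε K b n h t ω - f s|)
        + |f s / f₀ s - z|) ∂μ := by
        refine integral_mono_of_nonneg (Eventually.of_forall fun _ => abs_nonneg _)
          (i2.add (integrable_const _)) (Eventually.of_forall fun ω => ?_)
        exact (abs_sub_le _ (f s / f₀ s) _).trans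
          (add_le_add (abs_phatRatio_sub_le hK_nonneg n h t ω hpos) le_rfl)
    _ = _ := by
        rw [integral_add i2 (integrable_const _)]
        simp

theorem integral_sq_mul_abs_le {X D : Ω → ℝ} (hX : Measurable X)
    (hint : Integrable (fun ω => X ω ^ 2) μ) (hD : Measurable D) {C T : ℝ} (hT : 0 ≤ T)
    (hC : ∀ ω, |D ω| ≤ C) :
    ∫ ω, X ω ^ 2 * |D ω| ∂μ
      ≤ T * ∫ ω, |D ω| ∂μ + C * ∫ ω, (if T ≤ X ω ^ 2 then X ω ^ 2 else 0) ∂μ := by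
  have htail := integrable_sq_tail hX hint T
  have hDint : Integrable (fun ω => |D ω|) μ :=
    Integrable.of_bound hD.abs.aestronglyMeasurable C (Eventually.of_forall fun ω => by
      rw [Real.norm_eq_abs, abs_abs]
      exact hC ω)
  rw [← integral_const_mul, ← integral_const_mul, ← integral_add (hDint.const_mul _)
    (htail.const_mul _)]
  refine integral_mono_of_nonneg (Eventually.of_forall fun ω => by positivity)
    ((hDint.const_mul _).add (htail.const_mul _)) (Eventually.of_forall fun ω => ?_)
  dsimp only
  have hD0 := abs_nonneg (D ω)
  have hCω := hC ω
  split_ifs with hx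
  · nlinarith [sq_nonneg (X ω)]
  · rw [mul_zero, add_zero]
    exact mul_le_mul_of_nonneg_right (not_le.1 hx).le hD0

/-- Weighted averages of the squared innovations vanish in `L¹` if the bounded random weights
vanish in `L¹` along almost every rescaled time. -/
theorem tendsto_integral_abs_average_sq_mul (hε : ∀ n t, Measurable (ε n t))
    (hint : ∀ n t, 1 ≤ t → t ≤ n → Integrable (fun ω => ε n t ω ^ 2) μ)
    (hUI : ∀ e > 0, ∃ T : ℝ, 0 < T ∧ ∀ n t, 1 ≤ t → t ≤ n →
      ∫ ω, (if T ≤ ε n t ω ^ 2 then ε n t ω ^ 2 else 0) ∂μ ≤ e)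
    {D : ℕ → ℕ → Ω → ℝ} {C : ℝ} (hC : 0 ≤ C) (hDm : ∀ n t, Measurable (D n t))
    (hD : ∀ n t, 1 ≤ t → t ≤ n → ∀ ω, |D n t ω| ≤ C)
    (hlim : ∀ᵐ s ∂(volume.restrict (Ioc (0 : ℝ) 1)),
      Tendsto (fun n : ℕ => ∫ ω, |D n ⌈(n : ℝ) * s⌉₊ ω| ∂μ) atTop (nhds 0)) (h : ℕ) :
    Tendsto (fun n : ℕ => ∫ ω, |(n : ℝ)⁻¹ * ∑ t ∈ Finset.Icc (h + 1) n,
      ε n t ω ^ 2 * D n t ω| ∂μ) atTop (nhds 0) := by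
  obtain ⟨T₁, hT₁, htail₁⟩ := hUI 1 one_pos
  have habsint : ∀ n t, 1 ≤ t → t ≤ n → Integrable (fun ω => ε n t ω ^ 2 * |D n t ω|) μ :=
    fun n t h1 h2 => integrable_sq_mul (hint n t h1 h2) (hDm n t).abs fun ω => by
      rw [abs_abs]
      exact hD n t h1 h2 ω
  have hcesaro := tendsto_average_of_ae_tendsto_ceil (f := fun _ => 0) (C := T₁ * C + C)
    (F := fun n t => ∫ ω, ε n t ω ^ 2 * |D n t ω| ∂μ) (by
      intro n t h1 h2
      rw [abs_of_nonneg (integral_nonneg fun ω => by positivity)]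
      refine (integral_sq_mul_abs_le (hε n t) (hint n t h1 h2) (hDm n t) hT₁.le
        (hD n t h1 h2)).trans (add_le_add ?_ ?_)
      · gcongr
        refine (integral_mono_of_nonneg (Eventually.of_forall fun _ => abs_nonneg _)
          (integrable_const C) (Eventually.of_forall (hD n t h1 h2))).trans ?_
        simp
      · exact mul_le_of_le_one_right hC (htail₁ n t h1 h2)) (by
      filter_upwards [hlim, ae_restrict_mem measurableSet_Ioc] with s hs hmem
      rw [Metric.tendsto_nhds]
      intro e he
      obtain ⟨T, hT, htail⟩ := hUI (e / (2 * (C + 1))) (by positivity)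
      filter_upwards [hs.eventually (gt_mem_nhds (show 0 < e / (2 * T) by positivity)),
        eventually_gt_atTop 0] with n hn hn0
      have hn0' : (0 : ℝ) < n := by exact_mod_cast hn0
      have h1 : 1 ≤ ⌈(n : ℝ) * s⌉₊ := Nat.one_le_ceil_iff.2 (mul_pos hn0' hmem.1)
      have h2 : ⌈(n : ℝ) * s⌉₊ ≤ n := Nat.ceil_le.2 (mul_le_of_le_one_right hn0'.le hmem.2)
      rw [Real.dist_eq, sub_zero, abs_of_nonneg (integral_nonneg fun ω => by positivity)]
      refine (integral_sq_mul_abs_le (hε _ _) (hint _ _ h1 h2) (hDm _ _) hT.le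
        (hD _ _ h1 h2)).trans_lt ?_
      have h3 : T * ∫ ω, |D n ⌈(n : ℝ) * s⌉₊ ω| ∂μ < e / 2 := by
        rw [lt_div_iff₀ (by positivity)] at hn
        linarith
      have h4 : C * ∫ ω, (if T ≤ ε n ⌈(n : ℝ) * s⌉₊ ω ^ 2 then
          ε n ⌈(n : ℝ) * s⌉₊ ω ^ 2 else 0) ∂μ ≤ e / 2 := by
        calc _ ≤ C * (e / (2 * (C + 1))) := mul_le_mul_of_nonneg_left (htail _ _ h1 h2) hC
          _ ≤ (C + 1) * (e / (2 * (C + 1))) := by gcongr; linarith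
          _ = e / 2 := by field_simp
      linarith)
  rw [integral_zero] at hcesaro
  refine squeeze_zero (fun n => integral_nonneg fun ω => abs_nonneg _) (fun n => ?_) hcesaro
  have hsub : Finset.Icc (h + 1) n ⊆ Finset.Icc 1 n := Finset.Icc_subset_Icc (by omega) le_rfl
  have hti : ∀ t ∈ Finset.Icc 1 n, Integrable (fun ω => ε n t ω ^ 2 * |D n t ω|) μ := fun t ht =>
    habsint n t (Finset.mem_Icc.1 ht).1 (Finset.mem_Icc.1 ht).2
  rw [← integral_finsetSum _ hti, ← integral_const_mul]
  refine integral_mono_of_nonneg (Eventually.of_forall fun _ => abs_nonneg _)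
    ((integrable_finsetSum _ hti).const_mul _) (Eventually.of_forall fun ω => ?_)
  dsimp only
  rw [abs_mul, abs_of_nonneg (by positivity)]
  gcongr
  refine (Finset.abs_sum_le_sum_abs _ _).trans ?_
  refine (Finset.sum_le_sum_of_subset_of_nonneg hsub fun _ _ _ => abs_nonneg _).trans_eq ?_
  exact Finset.sum_congr rfl fun t _ => by rw [abs_mul, abs_of_nonneg (sq_nonneg _)]

/-- `L¹` law of large numbers for the squared innovations with deterministic weights. -/
theorem tendsto_integral_abs_average_weighted_sq (hα : Summable (alphaMix μ ε))
    (hε : ∀ n t, Measurable (ε n t))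
    (hint : ∀ n t, 1 ≤ t → t ≤ n → Integrable (fun ω => ε n t ω ^ 2) μ)
    (hUI : ∀ e > 0, ∃ T : ℝ, 0 < T ∧ ∀ n t, 1 ≤ t → t ≤ n →
      ∫ ω, (if T ≤ ε n t ω ^ 2 then ε n t ω ^ 2 else 0) ∂μ ≤ e)
    {f₀ w : ℝ → ℝ} {C C' : ℝ}
    (hsec : ∀ n t : ℕ, 1 ≤ t → t ≤ n → ∫ ω, ε n t ω ^ 2 ∂μ = f₀ ((t : ℝ) / n))
    (hw : ∀ s ∈ Ioc (0 : ℝ) 1, |w s| ≤ C) (hwf : ∀ s ∈ Ioc (0 : ℝ) 1, |w s * f₀ s| ≤ C')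
    (hcont : ∀ᵐ s ∂(volume.restrict (Ioc (0 : ℝ) 1)), ContinuousAt (fun s => w s * f₀ s) s)
    (h : ℕ) :
    Tendsto (fun n : ℕ => ∫ ω, |(n : ℝ)⁻¹ * ∑ t ∈ Finset.Icc (h + 1) n,
      w ((t : ℝ) / n) * ε n t ω ^ 2 - ∫ s in Ioc (0 : ℝ) 1, w s * f₀ s| ∂μ) atTop (nhds 0) := by
  have hC : 0 ≤ C := (abs_nonneg _).trans (hw 1 (by norm_num))
  have hlln := tendsto_integral_abs_average_sq hα hε hint hUI
    (c := fun n t => w ((t : ℝ) / n)) hC (fun n t h1 h2 => hw _ (natCast_div_mem_Ioc h1 h2)) h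
  have havg := ((tendsto_average_Icc h hwf hcont).sub_const
    (∫ s in Ioc (0 : ℝ) 1, w s * f₀ s)).abs
  rw [sub_self, abs_zero] at havg
  have hlim := hlln.add havg
  rw [add_zero] at hlim
  refine squeeze_zero (fun n => integral_nonneg fun ω => abs_nonneg _) (fun n => ?_) hlim
  have hi : Integrable (fun ω => |(n : ℝ)⁻¹ * ∑ t ∈ Finset.Icc (h + 1) n,
      w ((t : ℝ) / n) * (ε n t ω ^ 2 - ∫ ω, ε n t ω ^ 2 ∂μ)|) μ := by
    refine ((integrable_finsetSum _ fun t ht => ?_).const_mul _).abs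
    rw [Finset.mem_Icc] at ht
    exact ((hint n t (by omega) ht.2).sub (integrable_const _)).const_mul _
  refine (integral_mono_of_nonneg (Eventually.of_forall fun _ => abs_nonneg _)
    (hi.add (integrable_const (|(n : ℝ)⁻¹ * ∑ t ∈ Finset.Icc (h + 1) n,
      w ((t : ℝ) / n) * f₀ ((t : ℝ) / n) - ∫ s in Ioc (0 : ℝ) 1, w s * f₀ s|)))
    (Eventually.of_forall fun ω => ?_)).trans_eq ?_
  · refine le_of_eq_of_le (congrArg _ ?_) (abs_add_le _ _)
    rw [← add_sub_assoc, ← mul_add, ← Finset.sum_add_distrib]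
    congr 2
    refine Finset.sum_congr rfl fun t ht => ?_
    rw [Finset.mem_Icc] at ht
    rw [hsec n t (by omega) ht.2]
    ring
  · simp only [Pi.add_apply]
    rw [integral_add hi (integrable_const _)]
    simp

/-- `L¹` limit of the normalized sums of `r_t² p̂_{t,t-h} / p̂_t`. -/
theorem tendsto_integral_abs_average_rproc_sq_mul_phatRatio {f₀ f : ℝ → ℝ} {h : ℕ} {R M c : ℝ}
    (hα : Summable (alphaMix μ ε)) (hε : ∀ n t, Measurable (ε n t))
    (hint : ∀ n t, 1 ≤ t → t ≤ n → Integrable (fun ω => ε n t ω ^ 2) μ)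
    (hUI : ∀ e > 0, ∃ T : ℝ, 0 < T ∧ ∀ n t, 1 ≤ t → t ≤ n →
      ∫ ω, (if T ≤ ε n t ω ^ 2 then ε n t ω ^ 2 else 0) ∂μ ≤ e)
    (hsec : ∀ n t : ℕ, 1 ≤ t → t ≤ n → ∫ ω, ε n t ω ^ 2 ∂μ = f₀ ((t : ℝ) / n))
    (hprob₀ : ∀ n t : ℕ, 0 < t → t ≤ n →
      μ.real {ω | aproc v ε n t ω * aproc v ε n (t - 0) ω = 1} = f₀ ((t : ℝ) / n))
    (hprob : ∀ n t : ℕ, h < t → t ≤ n →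
      μ.real {ω | aproc v ε n t ω * aproc v ε n (t - h) ω = 1} = f ((t : ℝ) / n))
    (hc : 0 < c) (hvM : ∀ s ∈ Ioc (0 : ℝ) 1, |v s| ≤ M)
    (hf₀ : ∀ s ∈ Ioc (0 : ℝ) 1, c < f₀ s) (hf : ∀ s ∈ Ioc (0 : ℝ) 1, c < f s ∧ f s ≤ 1)
    (hvc : ∀ᵐ s ∂(volume.restrict (Ioc (0 : ℝ) 1)), ContinuousAt v s)
    (hf₀c : ∀ᵐ s ∂(volume.restrict (Ioc (0 : ℝ) 1)), ContinuousAt f₀ s)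
    (hfc : ∀ᵐ s ∂(volume.restrict (Ioc (0 : ℝ) 1)), ContinuousAt f s)
    (hK_cont : Continuous K) (hK_supp : HasCompactSupport K) (hK_nonneg : ∀ z, 0 ≤ K z)
    (hK_le : ∀ z, K z ≤ R) (hK_int : ∫ z : ℝ, K z = 1) (hb_pos : ∀ n, 0 < b n)
    (hb0 : Tendsto b atTop (nhds 0)) (hnb : Tendsto (fun n : ℕ => (n : ℝ) * b n) atTop atTop) :
    Tendsto (fun n : ℕ => ∫ ω, |(n : ℝ)⁻¹ * ∑ t ∈ Finset.Icc (h + 1) n,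
      rproc v ε n t ω ^ 2 * phatRatio v ε K b n h t ω
      - ∫ s in Ioc (0 : ℝ) 1, v s ^ 2 * f s| ∂μ) atTop (nhds 0) := by
  have hq : ∀ s ∈ Ioc (0 : ℝ) 1, |f s / f₀ s| ≤ c⁻¹ := by
    intro s hs
    have h0 := hf₀ s hs
    obtain ⟨h1, h2⟩ := hf s hs
    rw [abs_of_pos (div_pos (hc.trans h1) (hc.trans h0)), ← one_div]
    exact div_le_div₀ zero_le_one h2 hc h0.le
  have hv2 : ∀ s ∈ Ioc (0 : ℝ) 1, |v s ^ 2| ≤ M ^ 2 := by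
    intro s hs
    rw [abs_pow]
    exact pow_le_pow_left₀ (abs_nonneg _) (hvM s hs) 2
  set w : ℝ → ℝ := fun s => v s ^ 2 * (f s / f₀ s) with hw
  have hwC : ∀ s ∈ Ioc (0 : ℝ) 1, |w s| ≤ M ^ 2 * c⁻¹ := by
    intro s hs
    rw [hw, abs_mul]
    exact mul_le_mul (hv2 s hs) (hq s hs) (abs_nonneg _) (sq_nonneg _)
  have hwf : ∀ s ∈ Ioc (0 : ℝ) 1, w s * f₀ s = v s ^ 2 * f s := by
    intro s hs
    have := (hc.trans (hf₀ s hs)).ne'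
    rw [hw]
    field_simp
  have hwfC : ∀ s ∈ Ioc (0 : ℝ) 1, |w s * f₀ s| ≤ M ^ 2 * 1 := by
    intro s hs
    obtain ⟨h1, h2⟩ := hf s hs
    rw [hwf s hs, abs_mul]
    refine mul_le_mul (hv2 s hs) ?_ (abs_nonneg _) (sq_nonneg _)
    rwa [abs_of_pos (hc.trans h1)]
  have hwcont : ∀ᵐ s ∂(volume.restrict (Ioc (0 : ℝ) 1)),
      ContinuousAt (fun s => w s * f₀ s) s := by
    filter_upwards [hvc, hf₀c, hfc, ae_restrict_mem measurableSet_Ioc] with s h1 h2 h3 hs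
    exact ((h1.pow 2).mul (h3.div h2 (hc.trans (hf₀ s hs)).ne')).mul h2
  have hdet := tendsto_integral_abs_average_weighted_sq hα hε hint hUI hsec hwC hwfC hwcont h
  rw [setIntegral_congr_fun measurableSet_Ioc hwf] at hdet
  set D : ℕ → ℕ → Ω → ℝ := fun n t ω => v ((t : ℝ) / n) ^ 2 *
    (phatRatio v ε K b n h t ω - f ((t : ℝ) / n) / f₀ ((t : ℝ) / n)) with hD
  have hDm : ∀ n t, Measurable (D n t) := fun n t =>
    ((measurable_phatRatio hε K b n h t).sub_const _).const_mul _
  have hDle : ∀ n t, 1 ≤ t → t ≤ n → ∀ ω, |D n t ω| ≤ M ^ 2 * (1 + c⁻¹) := by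
    intro n t h1 h2 ω
    have hmem := natCast_div_mem_Ioc h1 h2
    rw [hD, abs_mul]
    refine mul_le_mul (hv2 _ hmem) ((abs_sub _ _).trans (add_le_add ?_ (hq _ hmem)))
      (abs_nonneg _) (sq_nonneg _)
    rw [abs_of_nonneg (phatRatio_nonneg hK_nonneg n h t ω)]
    exact phatRatio_le_one hK_nonneg n h t ω
  have hne1 : ∀ᵐ s ∂(volume.restrict (Ioc (0 : ℝ) 1)), s ≠ 1 :=
    ae_restrict_of_ae (Measure.ae_ne volume 1)
  have hrand := tendsto_integral_abs_average_sq_mul hε hint hUI (by positivity) hDm hDle (by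
    filter_upwards [hf₀c, hfc, hne1, ae_restrict_mem measurableSet_Ioc] with s h2 h3 h4 hs
    have hs1 : s ∈ Ioo (0 : ℝ) 1 := ⟨hs.1, lt_of_le_of_ne hs.2 h4⟩
    have := (tendsto_integral_abs_phatRatio_sub hα hε hprob₀ hprob hK_supp hK_nonneg hK_le hb_pos
      hb0 hs.1 (tendsto_sum_Kw hK_cont hK_nonneg hK_int hb_pos hb0 hnb hs1) h2 h3
      (hc.trans (hf₀ s hs))).const_mul (M ^ 2)
    rw [mul_zero] at this
    refine squeeze_zero' (Eventually.of_forall fun n => integral_nonneg fun ω => abs_nonneg _)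
      ?_ this
    filter_upwards [eventually_gt_atTop 0] with n hn
    have hn' : (0 : ℝ) < n := by exact_mod_cast hn
    have hmem := natCast_div_mem_Ioc (Nat.one_le_ceil_iff.2 (mul_pos hn' hs.1))
      (Nat.ceil_le.2 (mul_le_of_le_one_right hn'.le hs.2))
    rw [hD]
    simp only [abs_mul, integral_const_mul]
    exact mul_le_mul_of_nonneg_right (hv2 _ hmem) (integral_nonneg fun ω => abs_nonneg _)) h
  have hlim := hrand.add hdet
  rw [add_zero] at hlim
  refine squeeze_zero (fun n => integral_nonneg fun ω => abs_nonneg _) (fun n => ?_) hlim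
  have i1 : Integrable (fun ω => |(n : ℝ)⁻¹ * ∑ t ∈ Finset.Icc (h + 1) n,
      ε n t ω ^ 2 * D n t ω|) μ := by
    refine ((integrable_finsetSum _ fun t ht => ?_).const_mul _).abs
    rw [Finset.mem_Icc] at ht
    exact integrable_sq_mul (hint n t (by omega) ht.2) (hDm n t) (hDle n t (by omega) ht.2)
  have i2 : Integrable (fun ω => |(n : ℝ)⁻¹ * ∑ t ∈ Finset.Icc (h + 1) n,
      w ((t : ℝ) / n) * ε n t ω ^ 2 - ∫ s in Ioc (0 : ℝ) 1, v s ^ 2 * f s|) μ := by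
    refine (((integrable_finsetSum _ fun t ht => ?_).const_mul _).sub (integrable_const _)).abs
    rw [Finset.mem_Icc] at ht
    exact (hint n t (by omega) ht.2).const_mul _
  rw [← integral_add i1 i2]
  refine integral_mono_of_nonneg (Eventually.of_forall fun _ => abs_nonneg _) (i1.add i2)
    (Eventually.of_forall fun ω => ?_)
  refine le_of_eq_of_le (congrArg _ ?_) (abs_add_le _ _)
  rw [← add_sub_assoc, ← mul_add, ← Finset.sum_add_distrib]
  congr 2
  refine Finset.sum_congr rfl fun t _ => ?_
  simp only [hD, hw, rproc]
  ring

/-- A positive, bounded and almost everywhere continuous function has positive integral. -/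
theorem setIntegral_Ioc_pos {f : ℝ → ℝ} {C : ℝ} (hpos : ∀ s ∈ Ioc (0 : ℝ) 1, 0 < f s)
    (hf : ∀ s ∈ Ioc (0 : ℝ) 1, |f s| ≤ C)
    (hcont : ∀ᵐ s ∂(volume.restrict (Ioc (0 : ℝ) 1)), ContinuousAt f s) :
    0 < ∫ s in Ioc (0 : ℝ) 1, f s := by
  have hmeas : AEStronglyMeasurable f (volume.restrict (Ioc (0 : ℝ) 1)) := by
    refine aestronglyMeasurable_of_tendsto_ae atTop
      (f := fun (n : ℕ) (s : ℝ) => f ((⌈(n : ℝ) * s⌉₊ : ℝ) / n)) (fun n => ?_) ?_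
    · exact ((measurable_from_nat (f := fun t : ℕ => f ((t : ℝ) / n))).comp
        (Nat.measurable_ceil.comp (measurable_const_mul _))).aestronglyMeasurable
    · filter_upwards [hcont, ae_restrict_mem measurableSet_Ioc] with s hc hs
      exact hc.tendsto.comp (tendsto_ceil_mul_div hs.1.le)
  have hint : IntegrableOn f (Ioc (0 : ℝ) 1) :=
    Integrable.of_bound hmeas C
      ((ae_restrict_iff' measurableSet_Ioc).2 (Eventually.of_forall hf))
  rw [setIntegral_pos_iff_support_of_nonneg_ae
    ((ae_restrict_iff' measurableSet_Ioc).2 (Eventually.of_forall fun s hs => (hpos s hs).le)) hint]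
  have : Function.support f ∩ Ioc (0 : ℝ) 1 = Ioc 0 1 :=
    inter_eq_right.2 fun s hs => (hpos s hs).ne'
  simp [this]

theorem tendsto_natCast_div_sub (h : ℕ) :
    Tendsto (fun n : ℕ => (n : ℝ) / ((n : ℝ) - h)) atTop (nhds 1) := by
  have h1 : Tendsto (fun n : ℕ => (1 - (h : ℝ) / n)⁻¹) atTop (nhds 1) := by
    simpa using ((tendsto_const_div_atTop_nhds_zero_nat (h : ℝ)).const_sub 1).inv₀ (by norm_num)
  refine h1.congr' ?_
  filter_upwards [eventually_gt_atTop 0] with n hn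
  have hn' : (n : ℝ) ≠ 0 := by exact_mod_cast hn.ne'
  rw [one_sub_div hn', inv_div]

/-- Replacing the normalization `n⁻¹` by `(n - h)⁻¹` does not change limits in probability. -/
theorem tendstoInMeasure_sub_inv_mul {S : ℕ → Ω → ℝ} {x : ℝ} (h : ℕ) (hS0 : ∀ ω, S 0 ω = 0)
    (hS : TendstoInMeasure μ (fun (n : ℕ) ω => (n : ℝ)⁻¹ * S n ω) atTop (fun _ => x)) :
    TendstoInMeasure μ (fun (n : ℕ) ω => ((n : ℝ) - h)⁻¹ * S n ω) atTop (fun _ => x) := by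
  have hd : TendstoInMeasure μ (fun (n : ℕ) (_ : Ω) => (n : ℝ) / ((n : ℝ) - h)) atTop
      (fun _ => 1) :=
    tendstoInMeasure_of_tendsto_ae (fun n => aestronglyMeasurable_const)
      (Eventually.of_forall fun _ => tendsto_natCast_div_sub h)
  have hmul := tendstoInMeasure_comp₂ μ (F := fun a b => a * b) hd hS continuous_mul.continuousAt
  rw [one_mul] at hmul
  convert hmul using 3 with n ω
  rcases Nat.eq_zero_or_pos n with rfl | hn
  · simp [hS0]
  · have hn' : (n : ℝ) ≠ 0 := by exact_mod_cast hn.ne'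
    rw [div_eq_mul_inv, mul_comm (n : ℝ), mul_assoc, mul_inv_cancel_left₀ hn']

theorem tendstoInMeasure_sum_sq {X : ℕ → ℕ → Ω → ℝ} {s : Finset ℕ}
    (hX : ∀ h ∈ s, TendstoInMeasure μ (fun n => X n h) atTop (fun _ => 0)) :
    TendstoInMeasure μ (fun n ω => ∑ h ∈ s, X n h ω ^ 2) atTop (fun _ => 0) := by
  induction s using Finset.induction_on with
  | empty =>
    refine tendstoInMeasure_of_tendsto_ae (fun n => ?_) (Eventually.of_forall fun ω => ?_)
    · simpa using aestronglyMeasurable_const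
    · simp
  | insert a s ha ih =>
    have := tendstoInMeasure_comp₂ μ (F := fun x y => x ^ 2 + y)
      (hX a (Finset.mem_insert_self a s))
      (ih fun h hs => hX h (Finset.mem_insert_of_mem hs))
      (((continuous_fst.pow 2).add continuous_snd).continuousAt)
    simpa [Finset.sum_insert ha] using this

/-- Consistency of `Δ̂_h`. -/
theorem tendstoInMeasure_DeltaHat {g : ℕ → ℝ → ℝ} {h : ℕ} {R M c : ℝ}
    (hα : Summable (alphaMix μ ε)) (hε : ∀ n t, Measurable (ε n t))
    (hint : ∀ n t, 1 ≤ t → t ≤ n → Integrable (fun ω => ε n t ω ^ 2) μ)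
    (hUI : ∀ e > 0, ∃ T : ℝ, 0 < T ∧ ∀ n t, 1 ≤ t → t ≤ n →
      ∫ ω, (if T ≤ ε n t ω ^ 2 then ε n t ω ^ 2 else 0) ∂μ ≤ e)
    (hsec : ∀ n t : ℕ, 1 ≤ t → t ≤ n → ∫ ω, ε n t ω ^ 2 ∂μ = g 0 ((t : ℝ) / n))
    (hprob₀ : ∀ n t : ℕ, 0 < t → t ≤ n →
      μ.real {ω | aproc v ε n t ω * aproc v ε n (t - 0) ω = 1} = g 0 ((t : ℝ) / n))
    (hprob : ∀ n t : ℕ, h < t → t ≤ n →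
      μ.real {ω | aproc v ε n t ω * aproc v ε n (t - h) ω = 1} = g h ((t : ℝ) / n))
    (hc : 0 < c) (hv_pos : ∀ s ∈ Ioc (0 : ℝ) 1, 0 < v s)
    (hvM : ∀ s ∈ Ioc (0 : ℝ) 1, |v s| ≤ M)
    (hg₀ : ∀ s ∈ Ioc (0 : ℝ) 1, c < g 0 s ∧ g 0 s ≤ 1)
    (hg : ∀ s ∈ Ioc (0 : ℝ) 1, c < g h s ∧ g h s ≤ 1)
    (hvc : ∀ᵐ s ∂(volume.restrict (Ioc (0 : ℝ) 1)), ContinuousAt v s)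
    (hg₀c : ∀ᵐ s ∂(volume.restrict (Ioc (0 : ℝ) 1)), ContinuousAt (g 0) s)
    (hgc : ∀ᵐ s ∂(volume.restrict (Ioc (0 : ℝ) 1)), ContinuousAt (g h) s)
    (hK_cont : Continuous K) (hK_supp : HasCompactSupport K) (hK_nonneg : ∀ z, 0 ≤ K z)
    (hK_le : ∀ z, K z ≤ R) (hK_int : ∫ z : ℝ, K z = 1) (hb_pos : ∀ n, 0 < b n)
    (hb0 : Tendsto b atTop (nhds 0)) (hnb : Tendsto (fun n : ℕ => (n : ℝ) * b n) atTop atTop) :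
    TendstoInMeasure μ (fun n => DeltaHat v ε K b n h) atTop (fun _ => Delta v g h) := by
  have habs : ∀ {f : ℝ → ℝ}, (∀ s ∈ Ioc (0 : ℝ) 1, c < f s ∧ f s ≤ 1) →
      ∀ s ∈ Ioc (0 : ℝ) 1, |f s| ≤ 1 := fun hf s hs => by
    rw [abs_of_pos (hc.trans (hf s hs).1)]
    exact (hf s hs).2
  have hv2 : ∀ s ∈ Ioc (0 : ℝ) 1, |v s ^ 2| ≤ M ^ 2 := by
    intro s hs
    rw [abs_pow]
    exact pow_le_pow_left₀ (abs_nonneg _) (hvM s hs) 2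
  have hvf : ∀ {f : ℝ → ℝ}, (∀ s ∈ Ioc (0 : ℝ) 1, c < f s ∧ f s ≤ 1) →
      ∀ s ∈ Ioc (0 : ℝ) 1, |v s ^ 2 * f s| ≤ M ^ 2 * 1 := fun hf s hs => by
    rw [abs_mul]
    exact mul_le_mul (hv2 s hs) (habs hf s hs) (abs_nonneg _) (sq_nonneg _)
  have hvfc : ∀ {f : ℝ → ℝ}, (∀ᵐ s ∂(volume.restrict (Ioc (0 : ℝ) 1)), ContinuousAt f s) →
      ∀ᵐ s ∂(volume.restrict (Ioc (0 : ℝ) 1)), ContinuousAt (fun s => v s ^ 2 * f s) s :=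
    fun hf => by
      filter_upwards [hvc, hf] with s h1 h2
      exact (h1.pow 2).mul h2
  have hr2 : TendstoInMeasure μ (fun (n : ℕ) ω => (n : ℝ)⁻¹ * ∑ t ∈ Finset.Icc 1 n,
      rproc v ε n t ω ^ 2) atTop (fun _ => ∫ s in Ioc (0 : ℝ) 1, v s ^ 2 * g 0 s) := by
    refine tendstoInMeasure_of_tendsto_integral_abs μ (fun n => ?_) ?_
    · refine (integrable_finsetSum _ fun t ht => ?_).const_mul _
      rw [Finset.mem_Icc] at ht
      simp only [rproc, mul_pow]
      exact (hint n t ht.1 ht.2).const_mul _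
    · simpa only [rproc, mul_pow, zero_add] using tendsto_integral_abs_average_weighted_sq hα hε
        hint hUI hsec hv2 (hvf hg₀) (hvfc hg₀c) 0
  have har2 : TendstoInMeasure μ (fun n => gammaAr2 v ε K b n h) atTop
      (fun _ => ∫ s in Ioc (0 : ℝ) 1, v s ^ 2 * g h s) :=
    tendstoInMeasure_sub_inv_mul (S := fun n ω => ∑ t ∈ Finset.Icc (h + 1) n,
      rproc v ε n t ω ^ 2 * phatRatio v ε K b n h t ω) h (fun ω => by simp)
      (tendstoInMeasure_of_tendsto_integral_abs μ
        (integrable_average_rproc_sq_mul hint hε hK_nonneg · h)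
        (tendsto_integral_abs_average_rproc_sq_mul_phatRatio hα hε hint hUI hsec hprob₀ hprob hc
          hvM (fun s hs => (hg₀ s hs).1) hg hvc hg₀c hgc hK_cont hK_supp hK_nonneg hK_le hK_int
          hb_pos hb0 hnb))
  have haint : ∀ k n : ℕ, Integrable (fun ω => (n : ℝ)⁻¹ * ∑ t ∈ Finset.Icc (k + 1) n,
      aproc v ε n t ω * aproc v ε n (t - k) ω) μ := by
    refine fun k n => (integrable_finsetSum _ fun t _ => ?_).const_mul _
    refine Integrable.of_bound ((measurable_aproc v ε (hε n t)).mul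
      (measurable_aproc v ε (hε n (t - k)))).aestronglyMeasurable 1
      (Eventually.of_forall fun ω => ?_)
    rw [Real.norm_eq_abs, abs_of_nonneg (mul_nonneg (aproc_nonneg v ε n t ω)
      (aproc_nonneg v ε n (t - k) ω))]
    exact mul_le_one₀ (aproc_le_one v ε n t ω) (aproc_nonneg v ε n (t - k) ω)
      (aproc_le_one v ε n (t - k) ω)
  have ha0 : TendstoInMeasure μ (fun (n : ℕ) ω => (n : ℝ)⁻¹ * ∑ t ∈ Finset.Icc 1 n, aproc v ε n t ω)
      atTop (fun _ => ∫ s in Ioc (0 : ℝ) 1, g 0 s) := by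
    have hsq : ∀ n t ω, aproc v ε n t ω * aproc v ε n t ω = aproc v ε n t ω := by
      intro n t ω
      unfold aproc
      split_ifs <;> simp
    simpa only [Nat.sub_zero, hsq, zero_add] using
      tendstoInMeasure_of_tendsto_integral_abs μ (haint 0)
        (tendsto_integral_abs_average_aproc hα hε hprob₀ (habs hg₀) hg₀c)
  have hah := tendstoInMeasure_sub_inv_mul (S := fun n ω => ∑ t ∈ Finset.Icc (h + 1) n,
      aproc v ε n t ω * aproc v ε n (t - h) ω) h (fun ω => by simp)
    (tendstoInMeasure_of_tendsto_integral_abs μ (haint h)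
      (tendsto_integral_abs_average_aproc hα hε hprob (habs hg) hgc))
  have hpos1 : 0 < ∫ s in Ioc (0 : ℝ) 1, v s ^ 2 * g h s :=
    setIntegral_Ioc_pos (fun s hs => mul_pos (pow_pos (hv_pos s hs) 2) (hc.trans (hg s hs).1))
      (hvf hg) (hvfc hgc)
  have hpos2 : 0 < ∫ s in Ioc (0 : ℝ) 1, g h s :=
    setIntegral_Ioc_pos (fun s hs => hc.trans (hg s hs).1) (habs hg) hgc
  exact tendstoInMeasure_comp₂ μ (F := fun x y => x - y)
    (tendstoInMeasure_comp₂ μ (F := fun x y => x / y) hr2 har2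
      (continuousAt_fst.div continuousAt_snd hpos1.ne'))
    (tendstoInMeasure_comp₂ μ (F := fun x y => x / y) ha0 hah
      (continuousAt_fst.div continuousAt_snd hpos2.ne')) continuous_sub.continuousAt

end Model

end Lemmas

/-- Under the non-stationary zero-returns model with mixing and the
kernel/bandwidth assumption, if `Δ = Σ_{h=1}^m Δ_h² = 0` then the index
`κ̂_m = Σ_{h=1}^m Δ̂_h²` converges in probability to `0`. -/
theorem stmt12 {Ω : Type*} [MeasurableSpace Ω] (μ : Measure Ω) [IsProbabilityMeasure μ]
    (m : ℕ) (v : ℝ → ℝ) (g : ℕ → ℝ → ℝ) (c : ℝ) (ε : ℕ → ℕ → Ω → ℝ) (ν μ2 : ℝ)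
    (K : ℝ → ℝ) (R : ℝ) (b : ℕ → ℝ)
    -- deterministic variance function `v`
    (hc : 0 < c)
    (hv_pos : ∀ s ∈ Set.Ioc (0 : ℝ) 1, 0 < v s)
    (hv_bdd : ∃ M, ∀ s ∈ Set.Ioc (0 : ℝ) 1, |v s| ≤ M)
    (hv_lip : PiecewiseLipschitzOn01 v)
    (hv_ext : ∃ L, Tendsto v (nhdsWithin 0 (Set.Ioi 0)) (nhds L) ∧ ∀ u ≤ (0 : ℝ), v u = L)
    -- deterministic zero-returns probability functions `g_h`, `h = 0,…,m`
    (hg_bnd : ∀ h ≤ m, ∀ s ∈ Set.Ioc (0 : ℝ) 1, c < g h s ∧ g h s ≤ 1)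
    (hg_lip : ∀ h ≤ m, PiecewiseLipschitzOn01 (g h))
    (hg_ext : ∀ h ≤ m, ∃ L, Tendsto (g h) (nhdsWithin 0 (Set.Ioi 0)) (nhds L) ∧
      ∀ u ≤ (0 : ℝ), g h u = L)
    -- the innovations are measurable and `P(a_t a_{t-h} = 1) = g_h(t/n)`
    (hε_meas : ∀ n t, Measurable (ε n t))
    (hprob : ∀ h ≤ m, ∀ n t : ℕ, h < t → t ≤ n →
      (μ {ω | aproc v ε n t ω * aproc v ε n (t - h) ω = 1}).toReal = g h ((t : ℝ) / n))
    -- identifiability: `E(ε_t | a_t = 1) = 0` and `E(ε_t² | a_t = 1) = 1`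
    (hident1 : ∀ n t : ℕ, 1 ≤ t → t ≤ n →
      ∫ ω, ε n t ω ∂(μ[|{ω | aproc v ε n t ω = 1}]) = 0)
    (hident2 : ∀ n t : ℕ, 1 ≤ t → t ≤ n →
      ∫ ω, (ε n t ω) ^ 2 ∂(μ[|{ω | aproc v ε n t ω = 1}]) = 1)
    -- conditional strict stationarity
    (hstat : ∀ n k t h : ℕ,
      (μ[|{ω | (∀ i ≤ k, aproc v ε n (t + i) ω = 1) ∧
          ∀ i ≤ k, aproc v ε n (t + h + i) ω = 1}]).map
        (fun ω => fun i : Fin (k + 1) => ε n (t + (i : ℕ)) ω)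
      = (μ[|{ω | (∀ i ≤ k, aproc v ε n (t + i) ω = 1) ∧
          ∀ i ≤ k, aproc v ε n (t + h + i) ω = 1}]).map
        (fun ω => fun i : Fin (k + 1) => ε n (t + h + (i : ℕ)) ω))
    -- strong mixing and moment conditions
    (hν : 0 < ν) (hμ2a : 1 ≤ μ2) (hμ2b : μ2 < 1 + ν) (hμ2c : 1 + ν < 2 * μ2)
    (hmix : Summable (fun h : ℕ => alphaMix μ ε h ^ (1 - 1 / (2 * μ2))))
    (hmom : ∃ M : ℝ, ∀ n t : ℕ, 1 ≤ t → t ≤ n →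
      ∫⁻ ω, ENNReal.ofReal (|ε n t ω| ^ (2 + 2 * ν)) ∂μ ≤ ENNReal.ofReal M)
    -- kernel and bandwidth assumption
    (hK_cont : Continuous K) (hK_supp : HasCompactSupport K)
    (hK_nonneg : ∀ z, 0 ≤ K z) (hK_le : ∀ z, K z ≤ R)
    (hK_int : ∫ z : ℝ, K z = 1)
    (hb_pos : ∀ n, 0 < b n)
    (hb0 : Tendsto b atTop (nhds 0))
    (hnb : Tendsto (fun n : ℕ => 1 / ((n : ℝ) * (b n) ^ 2)) atTop (nhds 0))
    (hΔ : ∑ h ∈ Finset.Icc 1 m, (Delta v g h) ^ 2 = 0) :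
    TendstoInMeasure μ
      (fun n : ℕ => fun ω => ∑ h ∈ Finset.Icc 1 m, (DeltaHat v ε K b n h ω) ^ 2) atTop
      (fun _ => 0) := by
  have hα : Summable (alphaMix μ ε) := by
    refine summable_alphaMix μ ε ?_ hmix
    have : 0 ≤ 1 / (2 * μ2) := by positivity
    linarith
  obtain ⟨M, hM⟩ := hv_bdd
  obtain ⟨Mε, hMε⟩ := hmom
  have hint : ∀ n t, 1 ≤ t → t ≤ n → Integrable (fun ω => ε n t ω ^ 2) μ := fun n t h1 h2 =>
    integrable_sq_of_rpow (hε_meas n t) (by linarith)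
      (integrable_rpow_of_lintegral_le (hε_meas n t) (hMε n t h1 h2)).1
  have hUI : ∀ e > 0, ∃ T : ℝ, 0 < T ∧ ∀ n t, 1 ≤ t → t ≤ n →
      ∫ ω, (if T ≤ ε n t ω ^ 2 then ε n t ω ^ 2 else 0) ∂μ ≤ e := by
    intro e he
    obtain ⟨T, hT, hle⟩ := exists_sq_tail_le (μ := μ) (M := Mε) hν he
    exact ⟨T, hT, fun n t h1 h2 => hle _ (hε_meas n t) (hMε n t h1 h2)⟩
  have hsec : ∀ n t : ℕ, 1 ≤ t → t ≤ n → ∫ ω, ε n t ω ^ 2 ∂μ = g 0 ((t : ℝ) / n) := by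
    intro n t h1 h2
    have hmem := natCast_div_mem_Ioc h1 h2
    exact integral_sq_eq_of_cond (hc.trans (hg_bnd 0 (Nat.zero_le m) _ hmem).1)
      (hv_pos _ hmem) (hprob 0 (Nat.zero_le m) n t h1 h2) (hident2 n t h1 h2)
  refine tendstoInMeasure_sum_sq fun h hh => ?_
  have hhm : h ≤ m := (Finset.mem_Icc.1 hh).2
  have hΔh : Delta v g h = 0 :=
    pow_eq_zero_iff two_ne_zero |>.1 ((Finset.sum_eq_zero_iff_of_nonneg
      fun _ _ => sq_nonneg _).1 hΔ h hh)
  rw [← hΔh]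
  exact tendstoInMeasure_DeltaHat hα hε_meas hint hUI hsec (hprob 0 (Nat.zero_le m))
    (hprob h hhm) hc hv_pos hM (hg_bnd 0 (Nat.zero_le m)) (hg_bnd h hhm) hv_lip.ae_continuousAt
    (hg_lip 0 (Nat.zero_le m)).ae_continuousAt (hg_lip h hhm).ae_continuousAt hK_cont hK_supp
    hK_nonneg hK_le hK_int hb_pos hb0 (tendsto_mul_bandwidth hb_pos hb0 hnb)

end ZeroReturnsNS
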